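/- arXiv:0904.3835 — 11 statements merged into one kernel-verified Lean document; each statement's English description precedes it below -/
import Mathlib

section
/- Let ρ ≥ 1 be an integer, let q' be a prime power, let q = (q')^{ρ+1}, and let v ≥ ρ+1. Let F_{q'} be the subfield of F_q with q' elements. If B is a set of points of the subgeometry PG(v,q') ⊂ PG(v,q) whose preimage in PG(v,q') is a (ρ+1)-fold strong blocking set of PG(v,q'), then B is a ρ-saturating set of the space PG(v,q). -/
noncomputable section

/-- `S` is a `ρ`-saturating set of points of the projective space `PG(m-1, F)`
(projectivization of `F^m`): every point lies in the projective subspace generated by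
some `ρ+1` points of `S`. -/
def IsSaturating (F : Type*) [Field F] (m ρ : ℕ)
    (S : Set (Projectivization F (Fin m → F))) : Prop :=
  ∀ P : Projectivization F (Fin m → F),
    ∃ p : Fin (ρ + 1) → Projectivization F (Fin m → F),
      (∀ i, p i ∈ S) ∧
        P.rep ∈ Submodule.span F (Set.range (fun i => (p i).rep))

/-- `B` is a `t`-fold strong blocking set of `PG(m-1, F)`: every `t`-dimensional
linear subspace of `F^m` (i.e. every `(t-1)`-dimensional projective subspace)
is the span of `t` points of `B`. -/
def IsStrongBlocking (F : Type*) [Field F] (m t : ℕ)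
    (B : Set (Projectivization F (Fin m → F))) : Prop :=
  ∀ W : Submodule F (Fin m → F), Module.finrank F W = t →
    ∃ p : Fin t → Projectivization F (Fin m → F),
      (∀ i, p i ∈ B) ∧
        Submodule.span F (Set.range (fun i => (p i).rep)) = W

/-- `B` is a `t`-fold blocking set of `PG(m-1, F)`:
every line meets `B` in at least `t` points. -/
def IsBlocking (F : Type*) [Field F] (m t : ℕ)
    (B : Set (Projectivization F (Fin m → F))) : Prop :=
  ∀ W : Submodule F (Fin m → F), Module.finrank F W = 2 →
    t ≤ {P | P ∈ B ∧ P.rep ∈ W}.ncard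

/-- The embedding of the subgeometry `PG(m-1, K)` into `PG(m-1, L)`, induced by applying
the inclusion `K ↪ L` coordinatewise to representative vectors. -/
def subgeom {m : ℕ} (K L : Type*) [Field K] [Field L] [Algebra K L]
    (P : Projectivization K (Fin m → K)) : Projectivization L (Fin m → L) :=
  Projectivization.mk L (fun i => algebraMap K L (P.rep i))
    (by
      intro h
      apply P.rep_nonzero
      funext i
      have hi : algebraMap K L (P.rep i) = 0 := congrFun h i
      exact (algebraMap K L).injective (by simpa using hi))

/-- The linear code `C` has covering radius exactly `R`: every vector is within Hamming
distance `R` of a codeword, and `R` is the least such value. -/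
def IsCovRadius {F : Type*} [Field F] [DecidableEq F] {n : ℕ}
    (C : Submodule F (Fin n → F)) (R : ℕ) : Prop :=
  (∀ x : Fin n → F, ∃ c ∈ C, hammingDist x c ≤ R) ∧
  (∃ x : Fin n → F, ∀ c ∈ C, R ≤ hammingDist x c)

/-- There exists a linear `[n, n-r]` code over `F` with covering radius `R`. -/
def ExistsCovCode (F : Type*) [Field F] [DecidableEq F] (n r R : ℕ) : Prop :=
  r ≤ n ∧ ∃ C : Submodule F (Fin n → F),
    Module.finrank F C = n - r ∧ IsCovRadius C R

/-- `V_q(n,R)`: the cardinality of a Hamming sphere of radius `R` in `F_q^n`. -/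
def sphereCard (q n R : ℕ) : ℕ :=
  ∑ i ∈ Finset.range (R + 1), (q - 1) ^ i * n.choose i

/-- In a finite-dimensional space, a subspace is contained in a subspace of any prescribed
dimension between its own and that of the whole space. -/
theorem exists_le_finrank_eq_of_le {K V : Type*} [Field K] [AddCommGroup V] [Module K V]
    [FiniteDimensional K V] (U : Submodule K V) {t : ℕ} (hU : Module.finrank K U ≤ t)
    (ht : t ≤ Module.finrank K V) :
    ∃ W : Submodule K V, U ≤ W ∧ Module.finrank K W = t := by
  induction t, hU using Nat.le_induction with
  | base => exact ⟨U, le_rfl, rfl⟩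
  | succ n _ ih =>
    obtain ⟨W, hUW, hW⟩ := ih (by omega)
    have hne : W ≠ ⊤ := by
      rintro rfl
      rw [finrank_top] at hW
      omega
    obtain ⟨x, -, hx⟩ := SetLike.exists_of_lt hne.lt_top
    have hlt : W < W ⊔ Submodule.span K {x} :=
      lt_of_le_of_ne le_sup_left fun h => hx <| by
        rw [h]
        exact Submodule.mem_sup_right (Submodule.mem_span_singleton_self x)
    have h₁ := Submodule.finrank_lt_finrank_of_lt hlt
    have h₂ := Submodule.finrank_add_le_finrank_add_finrank W (Submodule.span K {x})
    have h₃ : Module.finrank K (Submodule.span K {x}) ≤ 1 := by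
      simpa using finrank_span_le_card (R := K) ({x} : Set V)
    exact ⟨_, hUW.trans hlt.le, by omega⟩

/-- A vector over an extension `L` of `K` is an `L`-combination of images of `[L : K]` vectors
over `K`. -/
theorem exists_sum_smul_algebraMap_eq {K L ι κ : Type*} [Field K] [Field L] [Algebra K L]
    [Fintype κ] (b : Module.Basis κ K L) (x : ι → L) :
    ∃ u : κ → ι → K, x = ∑ j, b j • (Algebra.linearMap K L).compLeft ι (u j) := by
  refine ⟨fun j i => b.repr (x i) j, funext fun i => ?_⟩
  conv_lhs => rw [← b.sum_repr (x i)]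
  simp [Algebra.smul_def, mul_comm]

/-- The image in `F_L^m` of the chosen representative of a point over `K` lies on the line of
the corresponding subgeometry point. -/
theorem compLeft_rep_mem_span_subgeom_rep {m : ℕ} (K L : Type*) [Field K] [Field L] [Algebra K L]
    (P : Projectivization K (Fin m → K)) :
    (Algebra.linearMap K L).compLeft (Fin m) P.rep ∈
      Submodule.span L {(subgeom K L P).rep} := by
  rw [← Projectivization.submodule_eq, subgeom, Projectivization.submodule_mk]
  exact Submodule.mem_span_singleton_self _

/-- Theorem 4 of the paper. Any `(ρ+1)`-fold strong blocking set in the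
subgeometry `PG(v,q') ⊂ PG(v,q)`, `q = q'^{ρ+1}`, is a `ρ`-saturating set of `PG(v,q)`. -/
theorem statement0 (ρ : ℕ) (hρ : 1 ≤ ρ) (q' v : ℕ) (hv : ρ + 1 ≤ v)
    (K L : Type*) [Field K] [Fintype K] [Field L] [Fintype L] [Algebra K L]
    (hK : Fintype.card K = q') (hL : Fintype.card L = q' ^ (ρ + 1))
    (B : Set (Projectivization L (Fin (v + 1) → L)))
    (hBsub : B ⊆ Set.range (subgeom K L))
    (hBblock : IsStrongBlocking K (v + 1) (ρ + 1) (subgeom K L ⁻¹' B)) :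
    IsSaturating L (v + 1) ρ B := by
  have hrank : Module.finrank K L = ρ + 1 := by
    have h := Module.card_eq_pow_finrank (K := K) (V := L)
    rw [hL, ← hK] at h
    exact (Nat.pow_right_injective Fintype.one_lt_card h).symm
  intro P
  obtain ⟨u, hu⟩ := exists_sum_smul_algebraMap_eq (Module.finBasisOfFinrankEq K L hrank) P.rep
  obtain ⟨W, hUW, hW⟩ := exists_le_finrank_eq_of_le (Submodule.span K (Set.range u))
    ((finrank_range_le_card u).trans_eq (Fintype.card_fin _))
    (show ρ + 1 ≤ Module.finrank K (Fin (v + 1) → K) by simp; omega)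
  obtain ⟨p, hpB, hp⟩ := hBblock W hW
  refine ⟨fun i => subgeom K L (p i), hpB, ?_⟩
  set S := Submodule.span L (Set.range fun i => (subgeom K L (p i)).rep)
  have hWS : W ≤ (S.restrictScalars K).comap ((Algebra.linearMap K L).compLeft (Fin (v + 1))) := by
    rw [← hp, Submodule.span_le]
    rintro _ ⟨i, rfl⟩
    exact Submodule.span_mono (Set.singleton_subset_iff.2 (Set.mem_range_self i))
      (compLeft_rep_mem_span_subgeom_rep K L (p i))
  rw [hu]
  exact Submodule.sum_mem _ fun j _ => Submodule.smul_mem _ _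
    (hWS (hUW (Submodule.subset_span (Set.mem_range_self j))))
end
end

section
/- Let q' be a prime power and let q = (q')^2. If B is a set of points of the subgeometry PG(2,q') ⊂ PG(2,q) whose preimage in PG(2,q') is a 2-fold blocking set of the subplane PG(2,q'), then B is a 1-saturating set of the plane PG(2,q). -/
noncomputable section

/-- A subspace of dimension at most `n` extends to one of dimension exactly `n`, for every `n` up
to the dimension of the whole space. -/
theorem Submodule.exists_le_finrank_eq {F V : Type*} [Field F] [AddCommGroup V] [Module F V]
    [FiniteDimensional F V] (N : Submodule F V) {n : ℕ} (hN : Module.finrank F N ≤ n)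
    (hn : n ≤ Module.finrank F V) : ∃ W : Submodule F V, N ≤ W ∧ Module.finrank F W = n := by
  induction n, hN using Nat.le_induction with
  | base => exact ⟨N, le_rfl, rfl⟩
  | succ n _ ih =>
    obtain ⟨W, hNW, hW⟩ := ih (by lia)
    have hW_ne : W ≠ ⊤ := by
      rintro rfl
      rw [finrank_top] at hW
      lia
    obtain ⟨v, -, hv⟩ := SetLike.exists_of_lt hW_ne.lt_top
    refine ⟨W ⊔ F ∙ v, hNW.trans le_sup_left, ?_⟩
    rw [Submodule.finrank_sup_span_singleton hv, hW]

/-- Two distinct projective points with representatives in a plane `W` span `W`. -/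
theorem Projectivization.span_rep_pair_eq {F V : Type*} [Field F] [AddCommGroup V] [Module F V]
    {W : Submodule F V} (hW : Module.finrank F W = 2) {P Q : Projectivization F V}
    (hPQ : P ≠ Q) (hP : P.rep ∈ W) (hQ : Q.rep ∈ W) :
    Submodule.span F {P.rep, Q.rep} = W := by
  have : FiniteDimensional F W := Module.finite_of_finrank_eq_succ hW
  refine Submodule.eq_of_le_of_finrank_eq
    (Submodule.span_le.2 (Set.insert_subset hP (Set.singleton_subset_iff.2 hQ))) ?_
  have := finrank_span_eq_card (Projectivization.linearIndependent_pair_iff_ne.2 hPQ)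
  rw [Matrix.range_cons, Matrix.range_cons, Matrix.range_empty, Set.union_empty,
    Set.singleton_union] at this
  rw [this, hW, Fintype.card_fin]

/-- Coordinatewise extension of scalars on vectors, as a linear map over the smaller field. -/
def extendCoords (K L ι : Type*) [Field K] [Field L] [Algebra K L] : (ι → K) →ₗ[K] (ι → L) :=
  (Algebra.linearMap K L).compLeft ι

theorem extendCoords_rep_mem_span {m : ℕ} (K L : Type*) [Field K] [Field L] [Algebra K L]
    (P : Projectivization K (Fin m → K)) :
    extendCoords K L (Fin m) P.rep ∈ Submodule.span L {(subgeom K L P).rep} := by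
  have hne : extendCoords K L (Fin m) P.rep ≠ 0 := fun h => P.rep_nonzero <| by
    funext i
    exact (algebraMap K L).injective (by simpa [extendCoords] using congrFun h i)
  have hmk : subgeom K L P = Projectivization.mk L (extendCoords K L (Fin m) P.rep) hne := rfl
  rw [← Projectivization.submodule_eq, hmk, Projectivization.submodule_mk]
  exact Submodule.mem_span_singleton_self _

/-- Every vector over `L` lies in the `L`-span of a `K`-rational subspace of dimension at most
`[L : K]`. -/
theorem exists_finrank_le_mem_span_extendCoords {K L ι : Type*} [Field K] [Field L] [Algebra K L]
    [FiniteDimensional K L] (v : ι → L) :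
    ∃ N : Submodule K (ι → K), Module.finrank K N ≤ Module.finrank K L ∧
      v ∈ Submodule.span L (extendCoords K L ι '' N) := by
  let b := Module.finBasis K L
  let a : Fin (Module.finrank K L) → ι → K := fun j i => b.repr (v i) j
  refine ⟨Submodule.span K (Set.range a), (finrank_range_le_card a).trans_eq
    (Fintype.card_fin _), ?_⟩
  have hv : v = ∑ j, b j • extendCoords K L ι (a j) := by
    funext i
    rw [Finset.sum_apply]
    conv_lhs => rw [← b.sum_repr (v i)]
    exact Finset.sum_congr rfl fun j _ => by simp [a, extendCoords, Algebra.smul_def, mul_comm]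
  rw [hv]
  exact Submodule.sum_mem _ fun j _ => Submodule.smul_mem _ _ <|
    Submodule.subset_span ⟨a j, Submodule.subset_span ⟨j, rfl⟩, rfl⟩

/-- Corollary 5. Any `2`-fold blocking set in the subplane
`PG(2,q') ⊂ PG(2,q)`, `q = q'^2`, is a `1`-saturating set of `PG(2,q)`. -/
theorem statement1 (q' : ℕ)
    (K L : Type*) [Field K] [Fintype K] [Field L] [Fintype L] [Algebra K L]
    (hK : Fintype.card K = q') (hL : Fintype.card L = q' ^ 2)
    (B : Set (Projectivization L (Fin 3 → L)))
    (hBsub : B ⊆ Set.range (subgeom K L))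
    (hBblock : IsBlocking K 3 2 (subgeom K L ⁻¹' B)) :
    IsSaturating L 3 1 B := by
  have hq : 1 < q' := hK ▸ Fintype.one_lt_card
  have hrank : Module.finrank K L = 2 := by
    have h := Module.card_eq_pow_finrank (K := K) (V := L)
    rw [hK, hL] at h
    exact (Nat.pow_right_injective hq h).symm
  intro X
  obtain ⟨N, hN, hX⟩ := exists_finrank_le_mem_span_extendCoords (K := K) X.rep
  obtain ⟨W, hNW, hW⟩ := N.exists_le_finrank_eq (hN.trans_eq hrank) (by simp)
  obtain ⟨P, Q, ⟨hPB, hPW⟩, ⟨hQB, hQW⟩, hPQ⟩ := (Set.one_lt_ncard_iff).1 (hBblock W hW)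
  refine ⟨![subgeom K L P, subgeom K L Q], Fin.forall_fin_two.2 ⟨hPB, hQB⟩, ?_⟩
  refine Submodule.span_le.2 ?_ hX
  set S := Submodule.span L
    (Set.range fun i => (![subgeom K L P, subgeom K L Q] i).rep) with hS
  have hmem (i : Fin 2) : (![subgeom K L P, subgeom K L Q] i).rep ∈ S :=
    Submodule.subset_span ⟨i, rfl⟩
  have hWS : W ≤ (S.restrictScalars K).comap (extendCoords K L (Fin 3)) := by
    rw [← Projectivization.span_rep_pair_eq hW hPQ hPW hQW, Submodule.span_le]
    refine Set.insert_subset ?_ (Set.singleton_subset_iff.2 ?_)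
    · exact (Submodule.span_singleton_le_iff_mem _ _).2 (hmem 0) (extendCoords_rep_mem_span K L P)
    · exact (Submodule.span_singleton_le_iff_mem _ _).2 (hmem 1) (extendCoords_rep_mem_span K L Q)
  rintro _ ⟨w, hw, rfl⟩
  exact hWS (hNW hw)
end
end

section
/- Let q' be a prime power and let q = (q')^4. Then the plane PG(2,q) contains a 1-saturating set of size 2(q')^2 + 2q' + 2 (that is, of size 2√q + 2·q^{1/4} + 2). -/
noncomputable section

open Module in
/-- A finite field of order `s ^ d`, with `s` a prime power, has a subfield of order `s`. -/
theorem exists_subfield_natCard_eq (L : Type*) [Field L] [Finite L] {s d : ℕ} (hs : IsPrimePow s)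
    (hL : Nat.card L = s ^ d) : ∃ K : Subfield L, Nat.card K = s := by
  obtain ⟨p, n, hp, hn, rfl⟩ := (isPrimePow_nat_iff _).1 hs
  have : Fact p.Prime := ⟨hp⟩
  have : Fintype L := Fintype.ofFinite L
  have : CharP L p := by
    apply charP_of_card_eq_prime_pow (f := n * d)
    rw [Nat.card_eq_fintype_card] at *
    rw [hL, pow_mul]
  let _ : Algebra (ZMod p) L := ZMod.algebra L p
  have hfin : finrank (ZMod p) L = n * d := by
    apply Nat.pow_right_injective hp.two_le
    simp only
    rw [FiniteField.pow_finrank_eq_natCard, hL, pow_mul]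
  obtain ⟨f⟩ := FiniteField.nonempty_algHom_of_finrank_dvd (F := ZMod p) (K := GaloisField p n)
    (L := L) (by rw [hfin, GaloisField.finrank p hn.ne']; exact dvd_mul_right _ _)
  refine ⟨(f : GaloisField p n →+* L).fieldRange, ?_⟩
  rw [← GaloisField.card p n hn.ne']
  exact (Nat.card_congr (RingEquiv.ofBijective (f : GaloisField p n →+* L).rangeRestrictField
    ⟨(f : GaloisField p n →+* L).rangeRestrictField.injective,
      (f : GaloisField p n →+* L).rangeRestrictField_bijective.2⟩).toEquiv).symm

/-- A finite field of order `s ^ 4`, with `s` a prime power, has nested subfields of orders `s`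
and `s ^ 2`. -/
theorem exists_subfield_tower (L : Type*) [Field L] [Finite L] {s : ℕ} (hs : IsPrimePow s)
    (hL : Nat.card L = s ^ 4) :
    ∃ K M : Subfield L, K ≤ M ∧ Nat.card K = s ∧ Nat.card M = s ^ 2 := by
  obtain ⟨M, hM⟩ := exists_subfield_natCard_eq L (hs.pow two_ne_zero) (hL.trans (pow_mul s 2 2))
  obtain ⟨K, hK⟩ := exists_subfield_natCard_eq M hs hM
  refine ⟨K.map M.subtype, M, ?_, ?_, hM⟩
  · rintro _ ⟨x, -, rfl⟩
    exact x.2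
  · rw [← hK]
    exact Nat.card_image_of_injective Subtype.val_injective (K : Set M)

/-- An additive map from a finite group to a smaller one has a nonzero element in its kernel. -/
theorem AddMonoidHom.exists_ne_zero_map_eq_zero_of_natCard_lt {A B : Type*} [AddGroup A]
    [AddGroup B] [Finite A] [Finite B] (f : A →+ B) (h : Nat.card B < Nat.card A) :
    ∃ a, a ≠ 0 ∧ f a = 0 := by
  by_contra! hf
  refine h.not_ge (Nat.card_le_card_of_injective f ((injective_iff_map_eq_zero f).2 fun a ha ↦ ?_))
  by_contra h0
  exact hf a h0 ha

/-- Every finite field has a `3 × 3` matrix without eigenvectors. -/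
theorem exists_linearMap_apply_ne_smul (K : Type*) [Field K] [Finite K] :
    ∃ A : (Fin 3 → K) →ₗ[K] (Fin 3 → K), ∀ x, x ≠ 0 → ∀ a : K, A x ≠ a • x := by
  have hinj : ¬ Function.Injective (fun x : K ↦ x ^ 3 - x) := fun h ↦
    zero_ne_one (h (by simp : (0 : K) ^ 3 - 0 = 1 ^ 3 - 1))
  rw [Finite.injective_iff_surjective, Function.Surjective] at hinj
  push Not at hinj
  obtain ⟨c, hc⟩ := hinj
  refine ⟨Matrix.mulVecLin !![0, 1, 0; 0, 0, 1; c, 1, 0], fun x hx a h ↦ ?_⟩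
  have h0 : x 1 = a * x 0 := by
    simpa [Matrix.mulVec, dotProduct, Fin.sum_univ_three] using congrFun h 0
  have h1 : x 2 = a * x 1 := by
    simpa [Matrix.mulVec, dotProduct, Fin.sum_univ_three] using congrFun h 1
  have h2 : c * x 0 + x 1 = a * x 2 := by
    simpa [Matrix.mulVec, dotProduct, Fin.sum_univ_three] using congrFun h 2
  by_cases hx0 : x 0 = 0
  · exact hx (funext fun i ↦ by fin_cases i <;> simp [h0, h1, hx0])
  · exact hc a (mul_right_cancel₀ hx0 (by linear_combination -h2 - a * h1 - (a ^ 2 - 1) * h0))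

/-- Two linearly independent vectors of `F ^ 3` in the kernel of a nonzero linear form span
this kernel. -/
theorem mem_span_pair_of_dotProduct_eq_zero {F : Type*} [Field F] {h u v w : Fin 3 → F}
    (hh : h ≠ 0) (huv : LinearIndependent F ![u, v]) (hu : u ⬝ᵥ h = 0) (hv : v ⬝ᵥ h = 0)
    (hw : w ⬝ᵥ h = 0) : w ∈ Submodule.span F {u, v} := by
  by_contra hmem
  have hli : LinearIndependent F ![w, u, v] := by
    refine linearIndependent_finCons.2 ⟨huv, ?_⟩
    rwa [Matrix.range_cons, Matrix.range_cons, Matrix.range_empty, Set.union_empty]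
  have hunit := Matrix.linearIndependent_rows_iff_isUnit (A := Matrix.of ![w, u, v]) |>.1 hli
  refine hh (Matrix.eq_zero_of_mulVec_eq_zero
    ((Matrix.isUnit_iff_isUnit_det _).1 hunit).ne_zero ?_)
  funext i
  fin_cases i <;> simp [Matrix.mulVec, hu, hv, hw]

section twistedEmb

variable {L : Type*} [Field L] (K : Subfield L) (θ : L) (A : (Fin 3 → K) →ₗ[K] (Fin 3 → K))

/-- The semilinear map `x ↦ x + θ • A x` from `K ^ 3` to `L ^ 3`. -/
def twistedEmb : (Fin 3 → K) →ₛₗ[K.subtype] (Fin 3 → L) where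
  toFun x i := x i + θ * A x i
  map_add' x y := by
    funext i
    simp
    ring
  map_smul' a x := by
    funext i
    simp
    ring

theorem twistedEmb_apply (x : Fin 3 → K) (i : Fin 3) : twistedEmb K θ A x i = x i + θ * A x i :=
  rfl

theorem twistedEmb_zero_injective : Function.Injective (twistedEmb K 0 A) := by
  intro x y h
  funext i
  simpa [twistedEmb_apply] using congrFun h i

variable {K θ A}

/-- The elements `1` and `θ` are linearly independent over `K` when `θ ∉ K`. -/
theorem eq_zero_of_add_mul_eq_zero (hθ : θ ∉ K) {a b : K} (h : (a + θ * b : L) = 0) :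
    a = 0 ∧ b = 0 := by
  have hb : b = 0 := by
    by_contra hb
    have hb' : (b : L) ≠ 0 := by simpa using hb
    apply hθ
    have : θ = ((-a / b : K) : L) := by
      push_cast
      rw [eq_div_iff hb']
      linear_combination h
    rw [this]
    exact SetLike.coe_mem _
  subst hb
  exact ⟨by simpa using h, rfl⟩

theorem twistedEmb_injective (hθ : θ ∉ K) : Function.Injective (twistedEmb K θ A) := by
  rw [injective_iff_map_eq_zero]
  intro x hx
  funext i
  exact (eq_zero_of_add_mul_eq_zero hθ (congrFun hx i)).1

theorem linearIndependent_twistedEmb (hθ : θ ∉ K) (hA : ∀ x, x ≠ 0 → ∀ a : K, A x ≠ a • x)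
    {x y : Fin 3 → K} (hx : x ≠ 0) (hy : y ≠ 0) :
    LinearIndependent L ![twistedEmb K 0 A x, twistedEmb K θ A y] := by
  obtain ⟨j, hj⟩ := Function.ne_iff.1 hx
  have hj' : (x j : L) ≠ 0 := by simpa using hj
  have hx' : twistedEmb K 0 A x ≠ 0 := by
    simpa using (twistedEmb_zero_injective K A).ne hx
  rw [LinearIndependent.pair_iff' hx']
  intro a h
  have hi (i) : a * x i = y i + θ * A y i := by
    simpa [twistedEmb_apply] using congrFun h i
  have key (i) : y i * x j = y j * x i ∧ A y i * x j = A y j * x i := by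
    have := eq_zero_of_add_mul_eq_zero hθ (a := y i * x j - y j * x i)
      (b := A y i * x j - A y j * x i) (by
        push_cast
        linear_combination x i * hi j - x j * hi i)
    exact ⟨sub_eq_zero.1 this.1, sub_eq_zero.1 this.2⟩
  have hyj : y j ≠ 0 := by
    intro h0
    refine hy (funext fun i ↦ ?_)
    have := (key i).1
    rw [h0, zero_mul] at this
    exact (mul_eq_zero.1 this).resolve_right hj
  refine hA y hy (A y j / y j) (funext fun i ↦ mul_right_cancel₀ hj ?_)
  have h1 := (key i).1
  have h2 := (key i).2
  simp only [Pi.smul_apply, smul_eq_mul]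
  rw [h2, mul_assoc, h1]
  field_simp

/-- A linear form on `L ^ 3` with coefficients in an extension `M` of `K` with `[M : K] < 3`
vanishes at a nonzero vector in the image of `K ^ 3`. -/
theorem exists_twistedEmb_dotProduct_eq_zero [Finite L] {M : Subfield L} (hKM : K ≤ M)
    (hcard : Nat.card M < Nat.card K ^ 3) (hθ : θ ∈ M) (h : Fin 3 → M) :
    ∃ x : Fin 3 → K, x ≠ 0 ∧ twistedEmb K θ A x ⬝ᵥ (fun i ↦ (h i : L)) = 0 := by
  have hmem (x : Fin 3 → K) : twistedEmb K θ A x ⬝ᵥ (fun i ↦ (h i : L)) ∈ M :=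
    sum_mem fun i _ ↦ mul_mem (add_mem (hKM (x i).2) (mul_mem hθ (hKM (A x i).2))) (h i).2
  let f : (Fin 3 → K) →+ M :=
    { toFun x := ⟨_, hmem x⟩
      map_zero' := Subtype.ext (by simp)
      map_add' x y := Subtype.ext (by simp [add_dotProduct]) }
  obtain ⟨x, hx, hfx⟩ := f.exists_ne_zero_map_eq_zero_of_natCard_lt
    (by simpa [Nat.card_fun] using hcard)
  exact ⟨x, hx, congrArg Subtype.val hfx⟩

end twistedEmb

/-- A vector of `L ^ 3` is annihilated by a nonzero linear form with coefficients in a subfield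
`M` with `[L : M] < 3`. -/
theorem exists_dotProduct_subfield_eq_zero {L : Type*} [Field L] [Finite L] (M : Subfield L)
    (hcard : Nat.card L < Nat.card M ^ 3) (w : Fin 3 → L) :
    ∃ h : Fin 3 → M, h ≠ 0 ∧ w ⬝ᵥ (fun i ↦ (h i : L)) = 0 := by
  let f : (Fin 3 → M) →+ L :=
    { toFun h := w ⬝ᵥ (fun i ↦ (h i : L))
      map_zero' := by simp [dotProduct]
      map_add' x y := by simp [dotProduct, mul_add, Finset.sum_add_distrib] }
  exact f.exists_ne_zero_map_eq_zero_of_natCard_lt (by simpa [Nat.card_fun] using hcard)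

/-- A set of points of `PG(m-1, F)` is `1`-saturating if every vector is in the span of two
nonzero vectors representing points of the set. -/
theorem isSaturating_one_of_forall_mem_span_pair {F : Type*} [Field F] {m : ℕ}
    {S : Set (Projectivization F (Fin m → F))}
    (h : ∀ w : Fin m → F, ∃ (u v : Fin m → F) (hu : u ≠ 0) (hv : v ≠ 0),
      Projectivization.mk F u hu ∈ S ∧ Projectivization.mk F v hv ∈ S ∧
        w ∈ Submodule.span F {u, v}) :
    IsSaturating F m 1 S := by
  intro P
  obtain ⟨u, v, hu, hv, huS, hvS, hw⟩ := h P.rep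
  refine ⟨![.mk F u hu, .mk F v hv], by simp [Fin.forall_fin_two, huS, hvS], ?_⟩
  refine Submodule.span_le.2 ?_ hw
  have hrep (i : Fin 2) (z : Fin m → F) (hz : z ≠ 0)
      (hi : ![Projectivization.mk F u hu, .mk F v hv] i = .mk F z hz) :
      z ∈ Submodule.span F (Set.range fun i ↦
        (![Projectivization.mk F u hu, .mk F v hv] i).rep) := by
    obtain ⟨a, ha⟩ := Projectivization.exists_smul_eq_mk_rep F z hz
    rw [← inv_smul_eq_iff.2 ha.symm, ← hi]
    exact Submodule.smul_mem _ _ (Submodule.subset_span ⟨i, rfl⟩)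
  rintro _ (rfl | rfl)
  · exact hrep 0 _ hu rfl
  · exact hrep 1 _ hv rfl

theorem IsSaturating.mono {F : Type*} [Field F] {m ρ : ℕ}
    {S T : Set (Projectivization F (Fin m → F))} (hS : IsSaturating F m ρ S) (hST : S ⊆ T) :
    IsSaturating F m ρ T := fun P ↦ by
  obtain ⟨p, hp, hP⟩ := hS P
  exact ⟨p, fun i ↦ hST (hp i), hP⟩

/-- Theorem 6. For `q = q'^4` the plane `PG(2,q)` contains a
`1`-saturating set of size `2√q + 2⁴√q + 2`. -/
theorem statement2 (q' : ℕ) (hq' : IsPrimePow q')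
    (L : Type*) [Field L] [Fintype L] (hL : Fintype.card L = q' ^ 4) :
    ∃ S : Set (Projectivization L (Fin 3 → L)),
      IsSaturating L 3 1 S ∧ S.ncard = 2 * q' ^ 2 + 2 * q' + 2 := by
  rw [← Nat.card_eq_fintype_card] at hL
  have hq2 : 2 ≤ q' := hq'.two_le
  obtain ⟨K, M, hKM, hK, hM⟩ := exists_subfield_tower L hq' hL
  obtain ⟨θ, hθM, hθK⟩ : ∃ θ ∈ M, θ ∉ K := by
    by_contra! hMK
    have hEq : K = M := le_antisymm hKM hMK
    rw [hEq, hM] at hK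
    nlinarith
  obtain ⟨A, hA⟩ := exists_linearMap_apply_ne_smul K
  have hinj₀ := twistedEmb_zero_injective K A
  have hinj := twistedEmb_injective (A := A) hθK
  have hMK : Nat.card M < Nat.card K ^ 3 := by
    rw [hM, hK]
    exact Nat.pow_lt_pow_right hq2 (by norm_num)
  have hLM : Nat.card L < Nat.card M ^ 3 := by
    rw [hL, hM, ← pow_mul]
    exact Nat.pow_lt_pow_right hq2 (by norm_num)
  set S := Set.range (Projectivization.map _ hinj₀) ∪ Set.range (Projectivization.map _ hinj)
  have hsat : IsSaturating L 3 1 S := by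
    refine isSaturating_one_of_forall_mem_span_pair fun w ↦ ?_
    obtain ⟨h, hh, hw⟩ := exists_dotProduct_subfield_eq_zero M hLM w
    obtain ⟨x, hx, hxh⟩ := exists_twistedEmb_dotProduct_eq_zero (A := A) hKM hMK (zero_mem M) h
    obtain ⟨y, hy, hyh⟩ := exists_twistedEmb_dotProduct_eq_zero (A := A) hKM hMK hθM h
    refine ⟨_, _, map_zero (twistedEmb K 0 A) ▸ hinj₀.ne hx,
      map_zero (twistedEmb K θ A) ▸ hinj.ne hy,
      .inl ⟨.mk K x hx, Projectivization.map_mk ..⟩, .inr ⟨.mk K y hy, Projectivization.map_mk ..⟩,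
      mem_span_pair_of_dotProduct_eq_zero ?_ (linearIndependent_twistedEmb hθK hA hx hy) hxh hyh hw⟩
    obtain ⟨i, hi⟩ := Function.ne_iff.1 hh
    exact Function.ne_iff.2 ⟨i, by simpa using hi⟩
  have hcardK : Nat.card (Projectivization K (Fin 3 → K)) = 1 + q' + q' ^ 2 := by
    rw [Projectivization.card_of_finrank K _ (Module.finrank_fin_fun K), hK]
    simp [Finset.sum_range_succ]
  have hcardL : Nat.card (Projectivization L (Fin 3 → L)) = 1 + q' ^ 4 + (q' ^ 4) ^ 2 := by
    rw [Projectivization.card_of_finrank L _ (Module.finrank_fin_fun L), hL]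
    simp [Finset.sum_range_succ]
  have hle : S.ncard ≤ 2 * q' ^ 2 + 2 * q' + 2 := by
    have h₁ := Finite.card_range_le (Projectivization.map _ hinj₀)
    have h₂ := Finite.card_range_le (Projectivization.map _ hinj)
    have h₃ := Set.ncard_union_le (Set.range (Projectivization.map _ hinj₀))
      (Set.range (Projectivization.map _ hinj))
    rw [Nat.card_coe_set_eq] at h₁ h₂
    lia
  have hle' : 2 * q' ^ 2 + 2 * q' + 2 ≤
      (Set.univ : Set (Projectivization L (Fin 3 → L))).ncard := by
    rw [Set.ncard_univ, hcardL]
    have h₁ : 4 ≤ q' ^ 2 := by nlinarith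
    nlinarith [sq_nonneg (q' ^ 2), sq_nonneg (q' ^ 4)]
  obtain ⟨T, hST, -, hT⟩ := Set.exists_subsuperset_card_eq (Set.subset_univ S) hle hle'
  exact ⟨T, hsat.mono hST, hT⟩
end
end

section
/- Let p ≤ 73 be a prime and let q = p^3. Then the plane PG(2,q) contains a 2-fold blocking set of size 2(q + p^2 + p + 1). -/
noncomputable section

section LinearSets

variable {K F V : Type*} [Field K] [Field F] [Algebra K F] [AddCommGroup V] [Module K V] {m : ℕ}

/-- The set of points of `PG(m-1, F)` represented by nonzero values of the `K`-linear map `f`. -/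
def linearPointSet (f : V →ₗ[K] (Fin m → F)) : Set (Projectivization F (Fin m → F)) :=
  {P | ∃ (v : V) (h : f v ≠ 0), P = Projectivization.mk F (f v) h}

lemma ncard_linearPointSet_le [Finite K] [Finite V] (f : V →ₗ[K] (Fin m → F))
    (hf : Function.Injective f) {n : ℕ} (hn : Module.finrank K V = n) :
    (linearPointSet f).ncard ≤ ∑ i ∈ Finset.range n, Nat.card K ^ i := by
  let g : V →ₛₗ[algebraMap K F] (Fin m → F) :=
    { toFun := f
      map_add' := f.map_add
      map_smul' := fun c v => by rw [map_smul, algebraMap_smul] }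
  have hsub : linearPointSet f ⊆ Set.range (Projectivization.map g hf) := by
    rintro _ ⟨v, hv, rfl⟩
    have hv0 : v ≠ 0 := by
      rintro rfl
      exact hv (map_zero f)
    exact ⟨Projectivization.mk K v hv0, Projectivization.map_mk g hf v hv0⟩
  rw [← Projectivization.card_of_finrank K V hn, ← Set.ncard_univ]
  refine (Set.ncard_le_ncard hsub (Set.finite_range _)).trans ?_
  rw [← Set.image_univ]
  exact Set.ncard_image_le Set.finite_univ

lemma exists_mem_linearPointSet [Finite F] [Finite V] (f : V →ₗ[K] (Fin m → F))
    (hf : Function.Injective f) (W : Submodule F (Fin m → F))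
    (hW : Nat.card ((Fin m → F) ⧸ W) < Nat.card V) :
    ∃ P ∈ linearPointSet f, P.rep ∈ W := by
  have : Finite ((Fin m → F) ⧸ W) := Finite.of_surjective _ W.mkQ_surjective
  have hninj : ¬ Function.Injective (fun v => W.mkQ (f v)) := fun h =>
    absurd (Nat.card_le_card_of_injective _ h) (not_le.mpr hW)
  simp only [Function.Injective, not_forall] at hninj
  obtain ⟨u, v, huv, hne⟩ := hninj
  have hmem : f (u - v) ∈ W := by
    rw [map_sub]
    exact (Submodule.Quotient.eq W).mp huv
  have h0 : f (u - v) ≠ 0 := fun h =>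
    hne (sub_eq_zero.mp (hf (h.trans (map_zero f).symm)))
  refine ⟨_, ⟨u - v, h0, rfl⟩, ?_⟩
  obtain ⟨a, ha⟩ := Projectivization.exists_smul_eq_mk_rep F (f (u - v)) h0
  rw [← ha]
  exact W.smul_mem (a : F) hmem

end LinearSets

lemma IsBlocking.mono {F : Type*} [Field F] [Finite F] {m t : ℕ}
    {A B : Set (Projectivization F (Fin m → F))} (hA : IsBlocking F m t A) (hAB : A ⊆ B) :
    IsBlocking F m t B := fun W hW =>
  (hA W hW).trans (Set.ncard_le_ncard (fun _ hP => ⟨hAB hP.1, hP.2⟩) (Set.toFinite _))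

lemma isBlocking_two_union {F : Type*} [Field F] [Finite F] {m : ℕ}
    {A B : Set (Projectivization F (Fin m → F))} (hAB : Disjoint A B)
    (hA : ∀ W : Submodule F (Fin m → F), Module.finrank F W = 2 → ∃ P ∈ A, P.rep ∈ W)
    (hB : ∀ W : Submodule F (Fin m → F), Module.finrank F W = 2 → ∃ P ∈ B, P.rep ∈ W) :
    IsBlocking F m 2 (A ∪ B) := by
  intro W hW
  obtain ⟨P, hP, hPW⟩ := hA W hW
  obtain ⟨Q, hQ, hQW⟩ := hB W hW
  have hPQ : P ≠ Q := fun h => Set.disjoint_left.mp hAB hP (h ▸ hQ)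
  rw [← Set.ncard_pair hPQ]
  refine Set.ncard_le_ncard ?_ (Set.toFinite _)
  rintro R (rfl | rfl)
  exacts [⟨Or.inl hP, hPW⟩, ⟨Or.inr hQ, hQW⟩]

section CubicExtension

variable {K F : Type*} [Field K] [Field F] [Algebra K F]

lemma quadratic_coeffs_eq_zero (h3 : Module.finrank K F = 3) {δ : F}
    (hδ : δ ∉ Set.range (algebraMap K F)) {a b c : K}
    (h : algebraMap K F a + algebraMap K F b * δ + algebraMap K F c * δ ^ 2 = 0) :
    a = 0 ∧ b = 0 ∧ c = 0 := by
  have : FiniteDimensional K F := FiniteDimensional.of_finrank_pos (by omega)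
  have hint : IsIntegral K δ := IsIntegral.of_finite K δ
  have hdvd := minpoly.degree_dvd hint
  rw [h3, Nat.dvd_prime Nat.prime_three] at hdvd
  have hdeg : (minpoly K δ).natDegree = 3 :=
    hdvd.resolve_left fun h1 => hδ (minpoly.natDegree_eq_one_iff.mp h1)
  have hli := linearIndependent_pow (K := K) δ
  rw [hdeg, Fintype.linearIndependent_iff] at hli
  have := hli ![a, b, c] (by simpa [Fin.sum_univ_three, Algebra.smul_def] using h)
  exact ⟨this 0, this 1, this 2⟩

/-- A linear functional whose values along `t ↦ (t + δ)⁻¹` avoid the identity. -/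
lemma exists_dual_inv_add_ne [Finite K] (h3 : Module.finrank K F = 3) {δ : F}
    (hδ : δ ∉ Set.range (algebraMap K F)) :
    ∃ ψ : F →ₗ[K] K, ∀ t : K, ψ (algebraMap K F t + δ)⁻¹ ≠ t := by
  have : FiniteDimensional K F := FiniteDimensional.of_finrank_pos (by omega)
  have hne (t : K) : algebraMap K F t + δ ≠ 0 := fun h =>
    hδ ⟨-t, by rw [map_neg]; linear_combination -h⟩
  have hδ0 : δ ≠ 0 := by simpa using hne 0
  have hlt : Submodule.span K {(1 : F), δ⁻¹} < ⊤ := by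
    refine lt_top_iff_ne_top.mpr fun h => ?_
    classical
    have hspan := finrank_span_finset_le_card (R := K) ({1, δ⁻¹} : Finset F)
    rw [Set.finrank, Finset.coe_pair, h, finrank_top, h3] at hspan
    have := hspan.trans Finset.card_le_two
    omega
  obtain ⟨ψ₁, hψ₁, hker⟩ := Submodule.exists_dual_map_eq_bot_of_lt_top hlt inferInstance
  have hvan : ∀ x ∈ Submodule.span K {(1 : F), δ⁻¹}, ψ₁ x = 0 := fun x hx => by
    have : ψ₁ x ∈ Submodule.map ψ₁ (Submodule.span K {(1 : F), δ⁻¹}) := ⟨x, hx, rfl⟩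
    simpa [hker] using this
  have h1 : ψ₁ 1 = 0 := hvan _ (Submodule.subset_span (by simp))
  have h2 : ψ₁ δ⁻¹ = 0 := hvan _ (Submodule.subset_span (by simp))
  have hψ₁ne (t : K) (ht : t ≠ 0) : ψ₁ (algebraMap K F t + δ)⁻¹ ≠ 0 := by
    intro h
    have hli : LinearIndependent K ![(1 : F), δ⁻¹, (algebraMap K F t + δ)⁻¹] := by
      rw [Fintype.linearIndependent_iff]
      intro g hg
      simp only [Fin.sum_univ_three, Algebra.smul_def, Matrix.cons_val] at hg
      have hg' : algebraMap K F (g 1 * t) + algebraMap K F (g 0 * t + g 1 + g 2) * δ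
          + algebraMap K F (g 0) * δ ^ 2 = 0 := by
        have := hne t
        field_simp at hg
        simp only [map_add, map_mul]
        linear_combination hg
      obtain ⟨ha, hb, hc⟩ := quadratic_coeffs_eq_zero h3 hδ hg'
      have hg1 : g 1 = 0 := (mul_eq_zero.mp ha).resolve_right ht
      have hg2 : g 2 = 0 := by simpa [hg1, hc] using hb
      intro i
      fin_cases i
      exacts [hc, hg1, hg2]
    have hspan := hli.span_eq_top_of_card_eq_finrank' (by simp [h3])
    refine hψ₁ (LinearMap.ext_on_range hspan fun i => ?_)
    fin_cases i
    · simpa using h1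
    · simpa using h2
    · simpa using h
  obtain ⟨ψ₀, hψ₀⟩ := Module.Projective.exists_dual_eq_one K (inv_ne_zero hδ0)
  classical
  let e : K → K := fun t =>
    (t - ψ₀ (algebraMap K F t + δ)⁻¹) / ψ₁ (algebraMap K F t + δ)⁻¹
  have hsurj : ¬ Function.Surjective (Function.update e 0 (e 1)) := by
    rw [← Finite.injective_iff_surjective]
    intro hinj
    exact zero_ne_one (hinj (a₁ := 0) (a₂ := (1 : K)) (by simp))
  simp only [Function.Surjective, not_forall, not_exists] at hsurj
  obtain ⟨c, hc⟩ := hsurj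
  refine ⟨ψ₀ + c • ψ₁, fun t ht => ?_⟩
  rcases eq_or_ne t 0 with rfl | ht0
  · simp [h2, hψ₀] at ht
  · apply hc t
    rw [Function.update_of_ne ht0]
    simp only [LinearMap.add_apply, LinearMap.smul_apply, smul_eq_mul] at ht
    rw [div_eq_iff (hψ₁ne t ht0)]
    linear_combination -ht

lemma exists_dual_one_eq_zero {δ : F} (hδ : δ ∉ Set.range (algebraMap K F)) :
    ∃ χ : F →ₗ[K] K, χ 1 = 0 ∧ χ δ = 1 := by
  have hmem : δ ∉ Submodule.span K {(1 : F)} := by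
    rw [Submodule.mem_span_singleton]
    rintro ⟨a, ha⟩
    exact hδ ⟨a, by rw [← ha, Algebra.smul_def, mul_one]⟩
  obtain ⟨f, hf, hker⟩ := Submodule.exists_dual_map_eq_bot_of_notMem hmem inferInstance
  have h1 : f 1 = 0 := by
    have : f 1 ∈ Submodule.map f (Submodule.span K {(1 : F)}) :=
      ⟨1, Submodule.mem_span_singleton_self 1, rfl⟩
    simpa [hker] using this
  exact ⟨(f δ)⁻¹ • f, by simp [h1], by simp [hf]⟩

/-- The map `(x, s) ↦ (x, s, ψ x)`. -/
def graphLeft (ψ : F →ₗ[K] K) : F × K →ₗ[K] (Fin 3 → F) where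
  toFun u := ![u.1, algebraMap K F u.2, algebraMap K F (ψ u.1)]
  map_add' u v := by
    ext i
    fin_cases i <;> simp
  map_smul' c u := by
    ext i
    fin_cases i <;> simp <;> simp [Algebra.smul_def]

/-- The map `(y, s) ↦ (s, χ y + δ s, y)`. -/
def graphRight (χ : F →ₗ[K] K) (δ : F) : F × K →ₗ[K] (Fin 3 → F) where
  toFun u := ![algebraMap K F u.2, algebraMap K F (χ u.1) + δ * algebraMap K F u.2, u.1]
  map_add' u v := by
    ext i
    fin_cases i <;> simp <;> ring
  map_smul' c u := by
    ext i
    fin_cases i <;> simp <;> simp [Algebra.smul_def] <;> ring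

lemma graphLeft_injective (ψ : F →ₗ[K] K) : Function.Injective (graphLeft ψ) := by
  intro u v h
  have h0 := congrFun h 0
  have h1 := congrFun h 1
  simp only [graphLeft, LinearMap.coe_mk, AddHom.coe_mk, Matrix.cons_val] at h0 h1
  exact Prod.ext h0 ((algebraMap K F).injective h1)

lemma graphRight_injective (χ : F →ₗ[K] K) (δ : F) : Function.Injective (graphRight χ δ) := by
  intro u v h
  have h0 := congrFun h 0
  have h2 := congrFun h 2
  simp only [graphRight, LinearMap.coe_mk, AddHom.coe_mk, Matrix.cons_val] at h0 h2
  exact Prod.ext h2 ((algebraMap K F).injective h0)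

lemma disjoint_graphLeft_graphRight {δ : F} (hδ : δ ∉ Set.range (algebraMap K F))
    {χ ψ : F →ₗ[K] K} (hχ1 : χ 1 = 0) (hχδ : χ δ = 1)
    (hψ : ∀ t : K, ψ (algebraMap K F t + δ)⁻¹ ≠ t) :
    Disjoint (linearPointSet (graphLeft ψ)) (linearPointSet (graphRight χ δ)) := by
  rw [Set.disjoint_left]
  rintro _ ⟨⟨x, s⟩, hx, rfl⟩ ⟨⟨y, r⟩, hy, h⟩
  obtain ⟨l, hl⟩ := (Projectivization.mk_eq_mk_iff' F _ _ hy hx).mp h.symm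
  have h0 := congrFun hl 0
  have h1 := congrFun hl 1
  have h2 := congrFun hl 2
  simp only [graphLeft, graphRight, LinearMap.coe_mk, AddHom.coe_mk, Pi.smul_apply,
    smul_eq_mul, Matrix.cons_val] at h0 h1 h2
  have hl0 : l ≠ 0 := by
    rintro rfl
    rw [zero_smul] at hl
    exact hy hl.symm
  have hne (t : K) : algebraMap K F t + δ ≠ 0 := fun h =>
    hδ ⟨-t, by rw [map_neg]; linear_combination -h⟩
  rcases eq_or_ne r 0 with rfl | hr
  · have hx0 : x = 0 := by simpa [hl0] using h0
    subst hx0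
    have hy0 : y = 0 := by simpa using h2.symm
    subst hy0
    exact hy (map_zero (graphRight χ δ))
  have hr' : algebraMap K F r ≠ 0 := by simpa using hr
  have hs : s ≠ 0 := by
    rintro rfl
    apply hne (χ y / r)
    rw [map_div₀]
    field_simp
    rw [map_zero, mul_zero] at h1
    linear_combination -h1
  have hs' : algebraMap K F s ≠ 0 := by simpa using hs
  have hyx : y = (χ y * (ψ x / s)) • (1 : F) + (r * (ψ x / s)) • δ := by
    simp only [Algebra.smul_def, map_mul, map_div₀]
    field_simp
    linear_combination (-algebraMap K F s) * h2 + algebraMap K F (ψ x) * h1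
  have hχy : χ y = r * (ψ x / s) := by
    have := congrArg χ hyx
    rwa [map_add, map_smul, map_smul, hχ1, hχδ, smul_zero, zero_add, smul_eq_mul,
      mul_one] at this
  have hxs : x = s • (algebraMap K F (ψ x / s) + δ)⁻¹ := by
    rw [Algebra.smul_def, eq_mul_inv_iff_mul_eq₀ (hne _)]
    apply mul_left_cancel₀ (mul_ne_zero hl0 hr')
    rw [hχy, map_mul] at h1
    linear_combination (algebraMap K F r * (algebraMap K F (ψ x / s) + δ)) * h0
      - algebraMap K F r * h1
  apply hψ (ψ x / s)
  have := congrArg ψ hxs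
  rw [map_smul, smul_eq_mul] at this
  rw [eq_div_iff hs, mul_comm]
  exact this.symm

end CubicExtension

/-- Theorem 7. For `q = p^3`, `p ≤ 73` prime, the plane `PG(2,q)`
contains a `2`-fold blocking set of size `2(q + p² + p + 1)`. -/
theorem statement3 (p : ℕ) (hp : p.Prime) (hp73 : p ≤ 73)
    (F : Type*) [Field F] [Fintype F] (hF : Fintype.card F = p ^ 3) :
    ∃ B : Set (Projectivization F (Fin 3 → F)),
      IsBlocking F 3 2 B ∧ B.ncard = 2 * (p ^ 3 + p ^ 2 + p + 1) := by
  have : Fact p.Prime := ⟨hp⟩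
  have : CharP F p := charP_of_card_eq_prime_pow hF
  let := ZMod.algebra F p
  have h3 : Module.finrank (ZMod p) F = 3 := by
    have h := Module.card_eq_pow_finrank (K := ZMod p) (V := F)
    rw [hF, ZMod.card] at h
    exact (Nat.pow_right_injective hp.two_le h).symm
  have h4 : Module.finrank (ZMod p) (F × ZMod p) = 4 := by simp [h3]
  have hcardF : Nat.card F = p ^ 3 := by rw [Nat.card_eq_fintype_card, hF]
  have hcardK : Nat.card (ZMod p) = p := Nat.card_zmod p
  obtain ⟨δ, hδ⟩ : ∃ δ : F, δ ∉ Set.range (algebraMap (ZMod p) F) := by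
    by_contra! h
    have hle := Nat.card_le_card_of_surjective (algebraMap (ZMod p) F) h
    rw [hcardF, hcardK] at hle
    nlinarith [hp.two_le, Nat.pow_lt_pow_right hp.one_lt (show 1 < 3 by norm_num)]
  obtain ⟨ψ, hψ⟩ := exists_dual_inv_add_ne h3 hδ
  obtain ⟨χ, hχ1, hχδ⟩ := exists_dual_one_eq_zero hδ
  have hquot (W : Submodule F (Fin 3 → F)) (hW : Module.finrank F W = 2) :
      Nat.card ((Fin 3 → F) ⧸ W) < Nat.card (F × ZMod p) := by
    have h1 : Module.finrank F ((Fin 3 → F) ⧸ W) = 1 := by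
      have := W.finrank_quotient_add_finrank
      rw [hW, Module.finrank_fin_fun] at this
      omega
    rw [Module.natCard_eq_pow_finrank (K := F), h1, pow_one, Nat.card_prod, hcardF, hcardK]
    exact lt_mul_of_one_lt_right (pow_pos hp.pos 3) hp.one_lt
  have hbound {f : F × ZMod p →ₗ[ZMod p] (Fin 3 → F)} (hf : Function.Injective f) :
      (linearPointSet f).ncard ≤ p ^ 3 + p ^ 2 + p + 1 := by
    have := ncard_linearPointSet_le f hf h4
    rw [hcardK] at this
    simp only [Finset.sum_range_succ, Finset.sum_range_zero] at this
    linarith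
  have hL := graphLeft_injective ψ
  have hR := graphRight_injective χ δ
  have hblock : IsBlocking F 3 2
      (linearPointSet (graphLeft ψ) ∪ linearPointSet (graphRight χ δ)) :=
    isBlocking_two_union (disjoint_graphLeft_graphRight hδ hχ1 hχδ hψ)
      (fun W hW => exists_mem_linearPointSet _ hL W (hquot W hW))
      (fun W hW => exists_mem_linearPointSet _ hR W (hquot W hW))
  have hle : (linearPointSet (graphLeft ψ) ∪ linearPointSet (graphRight χ δ)).ncard ≤
      2 * (p ^ 3 + p ^ 2 + p + 1) := by
    linarith [Set.ncard_union_le (linearPointSet (graphLeft ψ))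
      (linearPointSet (graphRight χ δ)), hbound hL, hbound hR]
  have htotal : 2 * (p ^ 3 + p ^ 2 + p + 1) ≤
      (Set.univ : Set (Projectivization F (Fin 3 → F))).ncard := by
    rw [Set.ncard_univ, Projectivization.card_of_finrank F (Fin 3 → F)
      (Module.finrank_fin_fun F), hcardF]
    simp only [Finset.sum_range_succ, Finset.sum_range_zero]
    have h2 := hp.two_le
    have hq : 2 * p ^ 2 ≤ p ^ 3 := by nlinarith [sq_nonneg p]
    have hp2 : 2 * p ≤ p ^ 2 := by nlinarith
    nlinarith
  obtain ⟨B, hB, -, hcard⟩ := Set.exists_subsuperset_card_eq (Set.subset_univ _) hle htotal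
  exact ⟨B, hblock.mono hB, hcard⟩
end
end

section
/- Let q' ≤ 73 be a prime and let q = (q')^6. Then the plane PG(2,q) contains a 1-saturating set of size 2(q')^3 + 2(q')^2 + 2q' + 2 (that is, of size 2√q + 2·q^{1/3} + 2·q^{1/6} + 2). -/
noncomputable section

lemma exists_linearEquiv_map_pair {k V : Type*} [Field k] [AddCommGroup V] [Module k V]
    {u v u' v' : V} (h : LinearIndependent k ![u, v]) (h' : LinearIndependent k ![u', v']) :
    ∃ g : V ≃ₗ[k] V, g u = u' ∧ g v = v' := by
  let f := h.linearCombinationEquiv.symm ≪≫ₗ h'.linearCombinationEquiv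
  have : FiniteDimensional k (Submodule.span k (Set.range ![u, v])) :=
    FiniteDimensional.span_of_finite k (Set.finite_range _)
  obtain ⟨g, hg⟩ := Submodule.exists_linearEquiv_restrict_eq f
  have hf : ∀ i, g (![u, v] i) = ![u', v'] i := fun i => by
    have h1 : (h.linearCombinationEquiv (Finsupp.single i 1) : V) = ![u, v] i := by simp
    have h2 : (h'.linearCombinationEquiv (Finsupp.single i 1) : V) = ![u', v'] i := by simp
    rw [← h1, ← hg, ← h2]
    simp only [f, LinearEquiv.trans_apply, LinearEquiv.symm_apply_apply]
  exact ⟨g, hf 0, hf 1⟩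

section PrimeField

variable {p : ℕ} [Fact p.Prime] {K : Type*} [Field K] [Algebra (ZMod p) K]

lemma algebraMap_zmod_pow (c : ZMod p) : algebraMap (ZMod p) K c ^ p = algebraMap (ZMod p) K c := by
  rw [← map_pow, ZMod.pow_card]

/-- Some element of a field with more than `p` elements is independent of its Frobenius image,
which is itself not a scalar. -/
lemma exists_frobenius_linearIndependent [Finite K] (hK : p < Nat.card K) :
    ∃ θ : K, LinearIndependent (ZMod p) ![θ, θ ^ p] ∧ LinearIndependent (ZMod p) ![1, θ ^ p] ∧
      θ ≠ θ ^ p := by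
  have hp : p.Prime := Fact.out
  have : CharP K p := charP_of_injective_algebraMap (algebraMap (ZMod p) K).injective p
  have : Fintype K := Fintype.ofFinite K
  obtain ⟨θ, hθ⟩ : ∃ θ : K, θ ^ p ≠ θ := by
    by_contra! h
    have := FiniteField.X_pow_card_sub_X_natDegree_eq K hp.one_lt
    have h0 := FiniteField.X_pow_card_sub_X_ne_zero K hp.one_lt
    have h1 := Polynomial.card_le_degree_of_subset_roots
      (p := (Polynomial.X ^ p - Polynomial.X : Polynomial K)) (Z := Finset.univ) (by
        intro x _
        simp [h0, h x, Polynomial.mem_roots'])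
    rw [this, Finset.card_univ, ← Nat.card_eq_fintype_card] at h1
    omega
  have key : ∀ t : K, t ^ p ≠ t → LinearIndependent (ZMod p) ![1, t ^ p] := by
    intro t ht
    rw [LinearIndependent.pair_iff' one_ne_zero]
    intro c hc
    apply ht
    rw [Algebra.smul_def, mul_one] at hc
    have : t = algebraMap (ZMod p) K c := by
      apply frobenius_inj K p
      rw [frobenius_def, frobenius_def, ← hc, algebraMap_zmod_pow]
    rw [← hc, ← this]
  have key2 : ∀ t : K, t ≠ 0 → ¬ LinearIndependent (ZMod p) ![t, t ^ p] →
      ∃ c : ZMod p, t ^ p = algebraMap (ZMod p) K c * t := by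
    intro t ht h
    rw [LinearIndependent.pair_iff' ht] at h
    push Not at h
    obtain ⟨c, hc⟩ := h
    exact ⟨c, by rw [← hc, Algebra.smul_def]⟩
  have hadd : (θ + 1) ^ p = θ ^ p + 1 := by rw [add_pow_char, one_pow]
  have hθ1 : (θ + 1) ^ p ≠ θ + 1 := by
    rw [hadd]; simpa using hθ
  by_cases h : LinearIndependent (ZMod p) ![θ, θ ^ p]
  · exact ⟨θ, h, key θ hθ, hθ.symm⟩
  refine ⟨θ + 1, ?_, key _ hθ1, hθ1.symm⟩
  by_contra h'
  obtain ⟨c, hc⟩ := key2 θ (by rintro rfl; simp [hp.ne_zero] at hθ) h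
  obtain ⟨d, hd⟩ := key2 (θ + 1) (by intro h0; simp [h0, hp.ne_zero] at hθ1) h'
  rw [hadd, hc] at hd
  by_cases hcd : c = d
  · subst hcd
    have : algebraMap (ZMod p) K c = 1 := by linear_combination -hd
    rw [this, one_mul] at hc
    exact hθ hc
  · apply hθ
    have hne : algebraMap (ZMod p) K (c - d) ≠ 0 := by
      simpa [sub_eq_zero] using hcd
    have : θ = algebraMap (ZMod p) K ((d - 1) / (c - d)) := by
      rw [map_div₀, eq_div_iff hne]
      simp only [map_sub, map_one]
      linear_combination hd
    rw [this, algebraMap_zmod_pow]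

lemma exists_linearEquiv_frobenius_ne [Finite K] (hK : p < Nat.card K) :
    ∃ (f : K ≃ₗ[ZMod p] K) (γ : K), γ ≠ 0 ∧
      ∀ x : K, x ≠ 0 → γ * x ^ p ≠ f x ^ (p - 1) := by
  have hp : p.Prime := Fact.out
  obtain ⟨θ, h1, h2, hne⟩ := exists_frobenius_linearIndependent hK
  obtain ⟨f, hf1, hf2⟩ := exists_linearEquiv_map_pair h1 h2
  have hθ0 : θ ≠ 0 := by rintro rfl; simp [hp.ne_zero] at hne
  let h : K → K := fun x => x ^ p / f x ^ (p - 1)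
  have hninj : ¬ Function.Injective h := by
    intro hi
    apply hne
    apply hi
    simp only [h, hf1, hf2]
    rw [one_pow, div_one, eq_div_iff (pow_ne_zero _ (pow_ne_zero _ hθ0))]
    rw [← pow_succ', Nat.sub_add_cancel hp.one_le]
  rw [Finite.injective_iff_surjective] at hninj
  simp only [Function.Surjective, not_forall, not_exists] at hninj
  obtain ⟨δ, hδ⟩ := hninj
  have hδ0 : δ ≠ 0 := by
    rintro rfl
    exact hδ 0 (by simp [h, hp.ne_zero])
  refine ⟨f, δ⁻¹, inv_ne_zero hδ0, fun x hx he => hδ x ?_⟩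
  have hfx : f x ≠ 0 := by simpa using hx
  simp only [h]
  rw [← he]
  field_simp

/-- Two disjoint `𝔽_p`-linear sets of rank `finrank K + 1` in the plane over `K`. -/
lemma exists_disjoint_linearMaps [Finite K] (hK : p < Nat.card K) :
    ∃ G₁ G₂ : (K × ZMod p) →ₗ[ZMod p] (Fin 3 → K),
      Function.Injective G₁ ∧ Function.Injective G₂ ∧
        ∀ u v, u ≠ 0 → v ≠ 0 → ∀ l : K, l • G₁ u ≠ G₂ v := by
  have hp : p.Prime := Fact.out
  have : CharP K p := charP_of_injective_algebraMap (algebraMap (ZMod p) K).injective p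
  obtain ⟨f, γ, hγ, hfγ⟩ := exists_linearEquiv_frobenius_ne hK
  let ι := algebraMap (ZMod p) K
  have hι : Function.Injective ι := ι.injective
  let F₁ : (K × ZMod p) →+ (Fin 3 → K) :=
    { toFun := fun u => ![u.1, f u.1, ι u.2]
      map_zero' := by ext i; fin_cases i <;> simp
      map_add' := fun u v => by ext i; fin_cases i <;> simp }
  let F₂ : (K × ZMod p) →+ (Fin 3 → K) :=
    { toFun := fun u => ![u.1, ι u.2, γ * u.1 ^ p]
      map_zero' := by ext i; fin_cases i <;> simp [hp.ne_zero]
      map_add' := fun u v => by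
        ext i; fin_cases i <;> simp [add_pow_char, mul_add] }
  refine ⟨F₁.toZModLinearMap p, F₂.toZModLinearMap p, ?_, ?_, ?_⟩
  · rintro ⟨x, c⟩ ⟨y, d⟩ h
    have h0 : x = y := congrFun h 0
    have h2 : ι c = ι d := congrFun h 2
    rw [h0, hι h2]
  · rintro ⟨x, c⟩ ⟨y, d⟩ h
    have h0 : x = y := congrFun h 0
    have h1 : ι c = ι d := congrFun h 1
    rw [h0, hι h1]
  · rintro ⟨x, c⟩ ⟨y, d⟩ - hv l h
    have h0 : l * x = y := congrFun h 0
    have h1 : l * f x = ι d := congrFun h 1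
    have h2 : l * ι c = γ * y ^ p := congrFun h 2
    by_cases hx : x = 0
    · subst hx
      have hy : y = 0 := by simpa using h0.symm
      have hd : ι d = 0 := by simpa using h1.symm
      exact hv (by rw [hy, hι (hd.trans (map_zero ι).symm)]; rfl)
    have hfx : f x ≠ 0 := by simpa using hx
    by_cases hl : l = 0
    · subst hl
      have hy : y = 0 := by simpa using h0.symm
      have hd : ι d = 0 := by simpa using h1.symm
      exact hv (by rw [hy, hι (hd.trans (map_zero ι).symm)]; rfl)
    have hd0 : d ≠ 0 := by
      rintro rfl
      simp [hl, hfx] at h1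
    have hpow : (l * f x) ^ (p - 1) = 1 := by
      rw [h1, ← map_pow, ZMod.pow_card_sub_one_eq_one hd0, map_one]
    have h3 : ι c * f x ^ (p - 1) = γ * x ^ p := by
      have hlp : l ^ p = l * l ^ (p - 1) := by
        rw [← pow_succ', Nat.sub_add_cancel hp.one_le]
      rw [← h0, mul_pow, hlp] at h2
      rw [mul_pow] at hpow
      have h4 : ι c = γ * (l ^ (p - 1) * x ^ p) := mul_left_cancel₀ hl (by
        rw [h2]; ring)
      rw [h4]
      linear_combination γ * x ^ p * hpow
    have hc0 : c ≠ 0 := by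
      rintro rfl
      simp [hγ, hx] at h3
    have hιc : ι c ≠ 0 := by simpa [ι] using hc0
    apply hfγ (c⁻¹ • x) (by simp [hc0, hx])
    have hcp : (ι c)⁻¹ ^ p = (ι c)⁻¹ := by rw [inv_pow, algebraMap_zmod_pow]
    have hcp' : (ι c)⁻¹ ^ (p - 1) = 1 := by
      rw [← map_inv₀, ← map_pow, ZMod.pow_card_sub_one_eq_one (inv_ne_zero hc0), map_one]
    rw [map_smul, Algebra.smul_def, Algebra.smul_def, map_inv₀, mul_pow, mul_pow]
    change γ * ((ι c)⁻¹ ^ p * x ^ p) = (ι c)⁻¹ ^ (p - 1) * f x ^ (p - 1)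
    rw [hcp, hcp']
    field_simp
    linear_combination -h3

end PrimeField

section Subplane

variable {K L : Type*} [Field K] [Field L] [Algebra K L]

lemma smul_algebraMap_ne {u v : Fin 3 → K} (hu : u ≠ 0) (h : ∀ l : K, l • u ≠ v) (l : L) :
    l • (fun i => algebraMap K L (u i)) ≠ fun i => algebraMap K L (v i) := by
  intro hl
  obtain ⟨i, hi⟩ := Function.ne_iff.mp hu
  have hi' : algebraMap K L (u i) ≠ 0 := by simpa using hi
  have hli : ∀ j, l * algebraMap K L (u j) = algebraMap K L (v j) := fun j => congrFun hl j
  have hl' : l = algebraMap K L (v i / u i) := by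
    rw [map_div₀, eq_div_iff hi', hli]
  apply h (v i / u i)
  ext j
  apply (algebraMap K L).injective
  rw [← hli, hl']
  simp

lemma algebraMap_comp_ne_zero {u : Fin 3 → K} (hu : u ≠ 0) :
    (fun i => algebraMap K L (u i)) ≠ 0 := by
  obtain ⟨i, hi⟩ := Function.ne_iff.mp hu
  exact Function.ne_iff.mpr ⟨i, by simpa using hi⟩

lemma rep_mem_span_singleton {F V : Type*} [Field F] [AddCommGroup V] [Module F V] (v : V)
    (hv : v ≠ 0) : v ∈ Submodule.span F {(Projectivization.mk F v hv).rep} := by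
  obtain ⟨a, ha⟩ := Projectivization.exists_smul_eq_mk_rep F v hv
  rw [← ha, Submodule.mem_span_singleton]
  exact ⟨(a⁻¹ : Fˣ), by rw [← Units.smul_def, smul_smul]; simp⟩

/-- Over a quadratic extension `L` of `K`, a set of points of `PG(2, L)` containing two points of
every line of the subplane `PG(2, K)` is `1`-saturating. -/
lemma isSaturating_of_double_blocking (hKL : Module.finrank K L = 2)
    (S : Set (Projectivization L (Fin 3 → L)))
    (hS : ∀ a : Fin 3 → K, ∃ (u v : Fin 3 → K) (hu : u ≠ 0) (hv : v ≠ 0),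
      a ⬝ᵥ u = 0 ∧ a ⬝ᵥ v = 0 ∧ (∀ l : K, l • u ≠ v) ∧
      Projectivization.mk L _ (algebraMap_comp_ne_zero (L := L) hu) ∈ S ∧
      Projectivization.mk L _ (algebraMap_comp_ne_zero (L := L) hv) ∈ S) :
    IsSaturating L 3 1 S := by
  intro P
  set w := P.rep
  have : Module.Finite K L := Module.finite_of_finrank_pos (by omega)
  let φ : (Fin 3 → K) →ₗ[K] L := Fintype.linearCombination K w
  obtain ⟨a, ha, ha0⟩ := (Submodule.ne_bot_iff _).mp
    (LinearMap.ker_ne_bot_of_finrank_lt (f := φ) (by simp [hKL]))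
  obtain ⟨u, v, hu, hv, hau, hav, huv, huS, hvS⟩ := hS a
  set u' : Fin 3 → L := fun i => algebraMap K L (u i)
  set v' : Fin 3 → L := fun i => algebraMap K L (v i)
  let ψ : (Fin 3 → L) →ₗ[L] L := Fintype.linearCombination L (fun i => algebraMap K L (a i))
  have hψ : ∀ x, ψ x = ∑ i, x i * algebraMap K L (a i) := fun x => by
    simp [ψ, Fintype.linearCombination_apply]
  have hlift : ∀ x : Fin 3 → K, a ⬝ᵥ x = 0 → ψ (fun i => algebraMap K L (x i)) = 0 := by
    intro x hx
    rw [hψ]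
    simp_rw [← map_mul, ← map_sum]
    rw [← map_zero (algebraMap K L), ← hx, dotProduct]
    simp_rw [mul_comm]
  have hwker : w ∈ LinearMap.ker ψ := by
    rw [LinearMap.mem_ker, hψ, ← LinearMap.mem_ker.mp ha]
    simp [φ, Fintype.linearCombination_apply, Algebra.smul_def, mul_comm]
  have hψ0 : ψ ≠ 0 := by
    intro h0
    obtain ⟨i, hi⟩ := Function.ne_iff.mp ha0
    have := hψ (Pi.single i 1)
    simp [h0, Pi.single_apply] at this
    exact hi (by simpa using this.symm)
  have hrank : Module.finrank L (LinearMap.ker ψ) = 2 := by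
    have h1 := LinearMap.finrank_range_add_finrank_ker ψ
    rw [LinearMap.range_eq_top.mpr (LinearMap.surjective hψ0)] at h1
    simp at h1
    omega
  have hli : LinearIndependent L ![u', v'] :=
    (LinearIndependent.pair_iff' (algebraMap_comp_ne_zero hu)).mpr (smul_algebraMap_ne hu huv)
  have hspan : Submodule.span L (Set.range ![u', v']) = LinearMap.ker ψ := by
    apply Submodule.eq_of_le_of_finrank_eq
    · rw [Submodule.span_le]
      rintro _ ⟨i, rfl⟩
      fin_cases i
      · exact hlift u hau
      · exact hlift v hav
    · rw [finrank_span_eq_card hli, hrank]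
      simp
  refine ⟨![Projectivization.mk L u' (algebraMap_comp_ne_zero hu),
    Projectivization.mk L v' (algebraMap_comp_ne_zero hv)], ?_, ?_⟩
  · intro i
    fin_cases i
    · exact huS
    · exact hvS
  · rw [← hspan] at hwker
    refine Submodule.span_le.mpr ?_ hwker
    rintro _ ⟨i, rfl⟩
    fin_cases i
    · exact Submodule.span_mono (by rintro _ rfl; exact ⟨0, rfl⟩)
        (rep_mem_span_singleton u' (algebraMap_comp_ne_zero hu))
    · exact Submodule.span_mono (by rintro _ rfl; exact ⟨1, rfl⟩)
        (rep_mem_span_singleton v' (algebraMap_comp_ne_zero hv))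

end Subplane

section LinearSet

variable {k K L V : Type*} [Field k] [Field K] [Field L] [Algebra k K] [Algebra k L]
  [Algebra K L] [IsScalarTower k K L] [AddCommGroup V] [Module k V]

/-- The points of `PG(2, L)` represented by the nonzero vectors in the range of `G`. -/
def linearSet (L : Type*) [Field L] [Algebra K L] (G : V →ₗ[k] (Fin 3 → K)) :
    Set (Projectivization L (Fin 3 → L)) :=
  {P | ∃ (u : V) (hu : G u ≠ 0), P = Projectivization.mk L _ (algebraMap_comp_ne_zero hu)}

lemma ncard_linearSet_le [Finite k] [Finite V] (G : V →ₗ[k] (Fin 3 → K))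
    (hG : Function.Injective G) :
    (linearSet L G).ncard ≤ ∑ i ∈ Finset.range (Module.finrank k V), Nat.card k ^ i := by
  let g : V →ₛₗ[algebraMap k L] (Fin 3 → L) :=
    { toFun := fun u i => algebraMap K L (G u i)
      map_add' := fun u v => by ext i; simp
      map_smul' := fun c u => by
        ext i
        simp [Algebra.smul_def, IsScalarTower.algebraMap_apply k K L] }
  have hg : Function.Injective g := fun u v h => hG (by
    ext i
    exact (algebraMap K L).injective (congrFun h i))
  have : Finite (Projectivization k V) := (Projectivization.finite_iff_of_finite k V).mpr inferInstance
  rw [← Projectivization.card_of_finrank k V rfl]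
  have hsub : linearSet L G ⊆ Set.range (Projectivization.map g hg) := by
    rintro _ ⟨u, hu, rfl⟩
    exact ⟨Projectivization.mk k u (by rintro rfl; simp at hu), rfl⟩
  calc (linearSet L G).ncard ≤ (Set.range (Projectivization.map g hg)).ncard :=
        Set.ncard_le_ncard hsub (Set.finite_range _)
    _ ≤ _ := by
        rw [← Nat.card_coe_set_eq]
        exact Finite.card_range_le _

lemma exists_ne_zero_dotProduct_apply_eq_zero [Module.Finite k K] [Module.Finite k V]
    (G : V →ₗ[k] (Fin 3 → K))
    (hV : Module.finrank k K < Module.finrank k V) (a : Fin 3 → K) :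
    ∃ u : V, u ≠ 0 ∧ a ⬝ᵥ G u = 0 := by
  let φ : V →ₗ[k] K :=
    { toFun := fun u => a ⬝ᵥ G u
      map_add' := fun u v => by simp [dotProduct_add]
      map_smul' := fun c u => by simp [dotProduct_smul] }
  obtain ⟨u, hu, hu0⟩ := (Submodule.ne_bot_iff _).mp
    (LinearMap.ker_ne_bot_of_finrank_lt (f := φ) hV)
  exact ⟨u, hu0, hu⟩

end LinearSet

/-- Corollary 8. For `q = q'^6`, `q' ≤ 73` prime, the plane `PG(2,q)`
contains a `1`-saturating set of size `2√q + 2∛q + 2⁶√q + 2`. -/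
theorem statement4 (q' : ℕ) (hq' : q'.Prime) (h73 : q' ≤ 73)
    (L : Type*) [Field L] [Fintype L] (hL : Fintype.card L = q' ^ 6) :
    ∃ S : Set (Projectivization L (Fin 3 → L)),
      IsSaturating L 3 1 S ∧
      S.ncard = 2 * q' ^ 3 + 2 * q' ^ 2 + 2 * q' + 2 := by
  have : Fact q'.Prime := ⟨hq'⟩
  have hcard : Nat.card L = q' ^ 6 := by rw [Nat.card_eq_fintype_card, hL]
  have : CharP L q' := by
    obtain ⟨r, hr⟩ := CharP.exists L
    obtain ⟨n, hrp, hn⟩ := FiniteField.card L r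
    rw [hL] at hn
    have : q' ∣ r := hq'.dvd_of_dvd_pow (hn ▸ dvd_pow_self q' (by norm_num))
    rwa [(Nat.prime_dvd_prime_iff_eq hq' hrp).mp this]
  let _ : Algebra (ZMod q') L := ZMod.algebra L q'
  let K := GaloisField q' 3
  have hfL : Module.finrank (ZMod q') L = 6 :=
    Nat.pow_right_injective hq'.two_le ((FiniteField.pow_finrank_eq_natCard q' L).trans hcard)
  have hfK : Module.finrank (ZMod q') K = 3 := GaloisField.finrank q' (by norm_num)
  obtain ⟨σ⟩ : Nonempty (K →ₐ[ZMod q'] L) :=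
    FiniteField.nonempty_algHom_of_finrank_dvd (by rw [hfL, hfK]; norm_num)
  let _ : Algebra K L := σ.toRingHom.toAlgebra
  have : IsScalarTower (ZMod q') K L := IsScalarTower.of_algHom σ
  have hKL : Module.finrank K L = 2 := by
    have := Module.finrank_mul_finrank (ZMod q') K L
    rw [hfL, hfK] at this
    omega
  have hKcard : Nat.card K = q' ^ 3 := GaloisField.card q' 3 (by norm_num)
  have : Finite K := Nat.finite_of_card_ne_zero (by rw [hKcard]; exact pow_ne_zero _ hq'.ne_zero)
  obtain ⟨G₁, G₂, hG₁, hG₂, hdis⟩ := exists_disjoint_linearMaps (p := q') (K := K) (by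
    rw [hKcard]; exact lt_self_pow₀ hq'.one_lt (by norm_num))
  have hfV : Module.finrank (ZMod q') (K × ZMod q') = 4 := by
    rw [Module.finrank_prod, hfK, Module.finrank_self]
  have hle : (linearSet L G₁ ∪ linearSet L G₂).ncard ≤
      2 * q' ^ 3 + 2 * q' ^ 2 + 2 * q' + 2 := by
    have h1 := ncard_linearSet_le (L := L) G₁ hG₁
    have h2 := ncard_linearSet_le (L := L) G₂ hG₂
    rw [hfV, Nat.card_zmod] at h1 h2
    simp only [Finset.sum_range_succ, Finset.sum_range_zero] at h1 h2
    have := Set.ncard_union_le (linearSet L G₁) (linearSet L G₂)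
    linarith
  have hplane : 2 * q' ^ 3 + 2 * q' ^ 2 + 2 * q' + 2 ≤
      Nat.card (Projectivization L (Fin 3 → L)) := by
    rw [Projectivization.card_of_finrank L _ (n := 3) (by simp), hcard]
    simp only [Finset.sum_range_succ, Finset.sum_range_zero]
    have h2 := hq'.two_le
    have : 2 * q' ^ 3 + 2 * q' ^ 2 + 2 * q' + 2 ≤ 8 * q' ^ 3 := by
      nlinarith [pow_le_pow_right₀ hq'.one_le (show 2 ≤ 3 by norm_num),
        pow_le_pow_right₀ hq'.one_le (show 1 ≤ 3 by norm_num),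
        pow_le_pow_right₀ hq'.one_le (show 0 ≤ 3 by norm_num)]
    have h8 : 8 ≤ q' ^ 3 := Nat.pow_le_pow_left h2 3
    nlinarith [Nat.mul_le_mul_right (q' ^ 3) h8]
  have : Finite (Projectivization L (Fin 3 → L)) :=
    (Projectivization.finite_iff_of_finite L _).mpr inferInstance
  obtain ⟨S, hsub, -, hS⟩ := Set.exists_subsuperset_card_eq (Set.subset_univ _) hle
    (by rwa [Set.ncard_univ])
  refine ⟨S, isSaturating_of_double_blocking hKL S fun a => ?_, hS⟩
  obtain ⟨u, hu, hau⟩ := exists_ne_zero_dotProduct_apply_eq_zero G₁ (by omega) a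
  obtain ⟨v, hv, hav⟩ := exists_ne_zero_dotProduct_apply_eq_zero G₂ (by omega) a
  have hu' : G₁ u ≠ 0 := by simpa using hG₁.ne hu
  have hv' : G₂ v ≠ 0 := by simpa using hG₂.ne hv
  exact ⟨G₁ u, G₂ v, hu', hv', hau, hav, hdis u v hu hv,
    hsub (Or.inl ⟨u, hu', rfl⟩), hsub (Or.inr ⟨v, hv', rfl⟩)⟩
end
end

section
/- Let q be a prime power and work in PG(3,q) with homogeneous coordinates (x_0,x_1,x_2,x_3). Let l_1 be the line x_0 = x_2 = 0, let l_2 be the line x_1 = x_3 = 0, let l_3 be the line x_0 = x_3, x_1 = x_2, and let g be any line of PG(3,q) disjoint from the hyperbolic quadric Q : x_0 x_1 = x_2 x_3. Then the set B = l_1 ∪ l_2 ∪ l_3 ∪ g has exactly 4q + 4 points and is a 3-fold strong blocking set of PG(3,q). -/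
noncomputable section

/-- The set of points of the projective space lying in a linear subspace. -/
def projPoints {F V : Type*} [Field F] [AddCommGroup V] [Module F V] (W : Submodule F V) :
    Set (Projectivization F V) :=
  {P | P.rep ∈ W}

lemma mk_mem_projPoints {F V : Type*} [Field F] [AddCommGroup V] [Module F V]
    {W : Submodule F V} {v : V} (hv : v ≠ 0) :
    Projectivization.mk F v hv ∈ projPoints W ↔ v ∈ W := by
  obtain ⟨a, ha⟩ := Projectivization.exists_smul_eq_mk_rep F v hv
  change (Projectivization.mk F v hv).rep ∈ W ↔ v ∈ W
  rw [← ha]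
  exact W.smul_mem_iff_of_isUnit a.isUnit

lemma range_map_subtype_eq_projPoints {F V : Type*} [Field F] [AddCommGroup V] [Module F V]
    (W : Submodule F V) :
    Set.range (Projectivization.map W.subtype W.injective_subtype) = projPoints W := by
  ext P
  constructor
  · rintro ⟨P, rfl⟩
    induction P with
    | h v hv =>
      rw [Projectivization.map_mk, mk_mem_projPoints]
      exact v.2
  · intro hP
    refine ⟨Projectivization.mk F ⟨P.rep, hP⟩ fun h => P.rep_nonzero (congrArg Subtype.val h), ?_⟩
    simp [Projectivization.map_mk]

lemma ncard_projPoints_of_finrank_two {F V : Type*} [Field F] [Finite F] [AddCommGroup V]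
    [Module F V] {W : Submodule F V} (hW : Module.finrank F W = 2) :
    (projPoints W).ncard = Nat.card F + 1 := by
  rw [← range_map_subtype_eq_projPoints, ← Set.image_univ,
    Set.ncard_image_of_injective _ (Projectivization.map_injective _ W.injective_subtype),
    Set.ncard_univ, Projectivization.card_of_finrank_two F W hW]

lemma exists_mem_projPoints_inter {F V : Type*} [Field F] [AddCommGroup V] [Module F V]
    [FiniteDimensional F V] {L W : Submodule F V}
    (h : Module.finrank F V < Module.finrank F L + Module.finrank F W) :
    ∃ P, P ∈ projPoints L ∧ P ∈ projPoints W := by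
  have hne : L ⊓ W ≠ ⊥ := by
    intro hbot
    have h1 := Submodule.finrank_sup_add_finrank_inf_eq L W
    have h2 := Submodule.finrank_le (L ⊔ W)
    rw [hbot, finrank_bot] at h1
    lia
  obtain ⟨v, hv, hv0⟩ := Submodule.exists_mem_ne_zero_of_ne_bot hne
  exact ⟨Projectivization.mk F v hv0, (mk_mem_projPoints hv0).2 hv.1,
    (mk_mem_projPoints hv0).2 hv.2⟩

lemma finrank_ker_prod_eq_two {F : Type*} [Field F]
    (f : (Fin 4 → F) →ₗ[F] F × F) (hf : Function.Surjective f) :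
    Module.finrank F (LinearMap.ker f) = 2 := by
  have h1 := f.finrank_range_add_finrank_ker
  rw [LinearMap.range_eq_top.2 hf, finrank_top] at h1
  simp at h1
  lia

lemma span_range_rep_eq {F V : Type*} [Field F] [AddCommGroup V] [Module F V]
    [FiniteDimensional F V] {W : Submodule F V} (hW : Module.finrank F W = 3)
    {P₁ P₂ P₃ : Projectivization F V} (h₁ : P₁ ∈ projPoints W) (h₂ : P₂ ∈ projPoints W)
    (h₃ : P₃ ∈ projPoints W) (h₁₂ : P₁ ≠ P₂)
    (h : ∀ a b : F, a • P₁.rep + b • P₂.rep ≠ P₃.rep) :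
    Submodule.span F (Set.range fun i => (![P₃, P₁, P₂] i).rep) = W := by
  have hli : LinearIndependent F fun i => (![P₃, P₁, P₂] i).rep := by
    have he : (fun i => (![P₃, P₁, P₂] i).rep) = Fin.cons P₃.rep ![P₁.rep, P₂.rep] := by
      ext i
      fin_cases i <;> rfl
    rw [he, linearIndependent_finCons, Matrix.range_cons, Matrix.range_cons, Matrix.range_empty,
      Set.union_empty, Set.singleton_union, Submodule.mem_span_pair]
    exact ⟨Projectivization.linearIndependent_pair_iff_ne.2 h₁₂, fun ⟨a, b, hab⟩ => h a b hab⟩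
  refine Submodule.eq_of_le_of_finrank_eq (Submodule.span_le.2 ?_) ?_
  · rintro _ ⟨i, rfl⟩
    fin_cases i
    exacts [h₃, h₁, h₂]
  · rw [finrank_span_eq_card hli, hW, Fintype.card_fin]

/-- Theorem 9. In `PG(3,q)` the union `B` of the three pairwise skew
lines `l₁ : x₀ = x₂ = 0`, `l₂ : x₁ = x₃ = 0`, `l₃ : x₀ = x₃, x₁ = x₂` and any line `g`
disjoint from the hyperbolic quadric `Q : x₀x₁ = x₂x₃` has size `4q + 4` and
is a `3`-fold strong blocking set of `PG(3,q)`. -/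
theorem statement5 (F : Type*) [Field F] [Fintype F] (q : ℕ) (hq : Fintype.card F = q)
    (g : Set (Projectivization F (Fin 4 → F)))
    (hgline : ∃ W : Submodule F (Fin 4 → F), Module.finrank F W = 2 ∧
      g = {P : Projectivization F (Fin 4 → F) | P.rep ∈ W})
    (hgdisj : ∀ P ∈ g, P.rep 0 * P.rep 1 ≠ P.rep 2 * P.rep 3) :
    ({P : Projectivization F (Fin 4 → F) | P.rep 0 = 0 ∧ P.rep 2 = 0} ∪
      {P : Projectivization F (Fin 4 → F) | P.rep 1 = 0 ∧ P.rep 3 = 0} ∪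
      {P : Projectivization F (Fin 4 → F) | P.rep 0 = P.rep 3 ∧ P.rep 1 = P.rep 2} ∪
      g).ncard = 4 * q + 4 ∧
    IsStrongBlocking F 4 3
      ({P : Projectivization F (Fin 4 → F) | P.rep 0 = 0 ∧ P.rep 2 = 0} ∪
        {P : Projectivization F (Fin 4 → F) | P.rep 1 = 0 ∧ P.rep 3 = 0} ∪
        {P : Projectivization F (Fin 4 → F) | P.rep 0 = P.rep 3 ∧ P.rep 1 = P.rep 2} ∪
        g) := by
  obtain ⟨W₄, hW₄, rfl⟩ := hgline
  set f₁ : (Fin 4 → F) →ₗ[F] F × F := (LinearMap.proj 0).prod (LinearMap.proj 2) with hf₁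
  set f₂ : (Fin 4 → F) →ₗ[F] F × F := (LinearMap.proj 1).prod (LinearMap.proj 3) with hf₂
  set f₃ : (Fin 4 → F) →ₗ[F] F × F :=
    LinearMap.prod ((LinearMap.proj 0 : (Fin 4 → F) →ₗ[F] F) - LinearMap.proj 3)
      ((LinearMap.proj 1 : (Fin 4 → F) →ₗ[F] F) - LinearMap.proj 2) with hf₃
  have d₁ := finrank_ker_prod_eq_two f₁ fun x => ⟨![x.1, 0, x.2, 0], by simp [hf₁]⟩
  have d₂ := finrank_ker_prod_eq_two f₂ fun x => ⟨![0, x.1, 0, x.2], by simp [hf₂]⟩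
  have d₃ := finrank_ker_prod_eq_two f₃ fun x => ⟨![x.1, x.2, 0, 0], by simp [hf₃]⟩
  have e₁ : {P : Projectivization F (Fin 4 → F) | P.rep 0 = 0 ∧ P.rep 2 = 0} =
      projPoints (LinearMap.ker f₁) := by
    ext P
    simp [projPoints, hf₁]
  have e₂ : {P : Projectivization F (Fin 4 → F) | P.rep 1 = 0 ∧ P.rep 3 = 0} =
      projPoints (LinearMap.ker f₂) := by
    ext P
    simp [projPoints, hf₂]
  have e₃ : {P : Projectivization F (Fin 4 → F) | P.rep 0 = P.rep 3 ∧ P.rep 1 = P.rep 2} =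
      projPoints (LinearMap.ker f₃) := by
    ext P
    simp [projPoints, hf₃, sub_eq_zero]
  have e₄ : {P : Projectivization F (Fin 4 → F) | P.rep ∈ W₄} = projPoints W₄ := rfl
  have hext : ∀ P : Projectivization F (Fin 4 → F),
      ¬ (P.rep 0 = 0 ∧ P.rep 1 = 0 ∧ P.rep 2 = 0 ∧ P.rep 3 = 0) := by
    rintro P ⟨h0, h1, h2, h3⟩
    refine P.rep_nonzero (funext fun i => ?_)
    fin_cases i
    exacts [h0, h1, h2, h3]
  constructor
  · rw [Set.ncard_union_eq, Set.ncard_union_eq, Set.ncard_union_eq, e₁, e₂, e₃, e₄,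
      ncard_projPoints_of_finrank_two d₁, ncard_projPoints_of_finrank_two d₂,
      ncard_projPoints_of_finrank_two d₃, ncard_projPoints_of_finrank_two hW₄,
      Nat.card_eq_fintype_card, hq]
    · ring
    · rw [Set.disjoint_left]
      rintro P ⟨h0, h2⟩ ⟨h1, h3⟩
      exact hext P ⟨h0, h1, h2, h3⟩
    · rw [Set.disjoint_left]
      rintro P (⟨h0, h2⟩ | ⟨h1, h3⟩) ⟨h03, h12⟩
      · exact hext P ⟨h0, h12.trans h2, h2, h03.symm.trans h0⟩
      · exact hext P ⟨h03.trans h3, h1, h12.symm.trans h1, h3⟩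
    · rw [Set.disjoint_left]
      rintro P ((⟨h0, h2⟩ | ⟨h1, h3⟩) | ⟨h03, h12⟩) hP <;> apply hgdisj P hP
      · rw [h0, h2, zero_mul, zero_mul]
      · rw [h1, h3, mul_zero, mul_zero]
      · rw [h03, h12, mul_comm]
  · intro W hW
    have hmeet : ∀ L : Submodule F (Fin 4 → F), Module.finrank F L = 2 →
        ∃ P, P ∈ projPoints L ∧ P ∈ projPoints W := fun L hL =>
      exists_mem_projPoints_inter (by rw [hL, hW, Module.finrank_fin_fun]; norm_num)
    obtain ⟨P₁, h₁, w₁⟩ := hmeet _ d₁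
    obtain ⟨P₂, h₂, w₂⟩ := hmeet _ d₂
    obtain ⟨P₃, h₃, w₃⟩ := hmeet _ d₃
    obtain ⟨P₄, h₄, w₄⟩ := hmeet _ hW₄
    rw [← e₁] at h₁
    rw [← e₂] at h₂
    rw [← e₃] at h₃
    have h₁₂ : P₁ ≠ P₂ := by
      rintro rfl
      exact hext P₁ ⟨h₁.1, h₂.1, h₁.2, h₂.2⟩
    by_cases h : ∀ a b : F, a • P₁.rep + b • P₂.rep ≠ P₃.rep
    · refine ⟨![P₃, P₁, P₂], fun i => ?_, span_range_rep_eq hW w₁ w₂ w₃ h₁₂ h⟩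
      fin_cases i
      exacts [.inl (.inr h₃), .inl (.inl (.inl h₁)), .inl (.inl (.inr h₂))]
    · refine ⟨![P₄, P₁, P₂], fun i => ?_, span_range_rep_eq hW w₁ w₂ w₄ h₁₂ ?_⟩
      · fin_cases i
        exacts [.inr h₄, .inl (.inl (.inl h₁)), .inl (.inl (.inr h₂))]
      push Not at h
      obtain ⟨a, b, hab⟩ := h
      obtain ⟨h10, h12⟩ := h₁
      obtain ⟨h21, h23⟩ := h₂
      obtain ⟨h303, h312⟩ := h₃
      have c0 : b * P₂.rep 0 = P₃.rep 0 := by simpa [h10] using congrFun hab 0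
      have c1 : a * P₁.rep 1 = P₃.rep 1 := by simpa [h21] using congrFun hab 1
      have c2 : b * P₂.rep 2 = P₃.rep 2 := by simpa [h12] using congrFun hab 2
      have c3 : a * P₁.rep 3 = P₃.rep 3 := by simpa [h23] using congrFun hab 3
      have ha : a ≠ 0 := by
        rintro rfl
        rw [zero_mul] at c1 c3
        exact hext P₃ ⟨h303.trans c3.symm, c1.symm, h312.symm.trans c1.symm, c3.symm⟩
      have hb : b ≠ 0 := by
        rintro rfl
        rw [zero_mul] at c0 c2
        exact hext P₃ ⟨c0.symm, h312.trans c2.symm, c2.symm, h303.symm.trans c0.symm⟩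
      have hpolar : P₂.rep 0 * P₁.rep 1 = P₂.rep 2 * P₁.rep 3 := by
        refine mul_left_cancel₀ (mul_ne_zero ha hb) ?_
        linear_combination (a * P₁.rep 1) * (c0.trans (h303.trans c3.symm)) +
          (a * P₁.rep 3) * (c1.trans (h312.trans c2.symm))
      intro s t hst
      have k0 : t * P₂.rep 0 = P₄.rep 0 := by simpa [h10] using congrFun hst 0
      have k1 : s * P₁.rep 1 = P₄.rep 1 := by simpa [h21] using congrFun hst 1
      have k2 : t * P₂.rep 2 = P₄.rep 2 := by simpa [h12] using congrFun hst 2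
      have k3 : s * P₁.rep 3 = P₄.rep 3 := by simpa [h23] using congrFun hst 3
      apply hgdisj P₄ h₄
      rw [← k0, ← k1, ← k2, ← k3]
      linear_combination s * t * hpolar
end
end

section
/- Let q be a prime power and v ≥ 2. Let H be a hyperplane of PG(v+1,q), and let B ⊆ H be a set of k points such that every (v−1)-dimensional projective subspace of H is generated by v points of B (i.e., B is a v-fold strong blocking set of H ≅ PG(v,q)). Let P_1, …, P_{v+1} be v+1 projectively independent points of H, and let l_1, …, l_{v+1} be lines of PG(v+1,q) passing through a common point such that l_i ∩ H = {P_i} for each i. Then the set B* = B ∪ ⋃_{i=1}^{v+1} (l_i \ {P_i}) is a (v+1)-fold strong blocking set of PG(v+1,q) of size k + 1 + (v+1)(q−1). -/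
noncomputable section

namespace Projectivization

variable {F V : Type*} [Field F] [AddCommGroup V] [Module F V]

theorem rep_mk_mem_iff (W : Submodule F V) {x : V} (hx : x ≠ 0) :
    (mk F x hx).rep ∈ W ↔ x ∈ W := by
  obtain ⟨a, ha⟩ := exists_smul_eq_mk_rep F x hx
  rw [← ha]
  exact W.smul_mem_iff_of_isUnit a.isUnit

/-- A point outside a hyperplane `W'` of `W` extends a generating family of `W'` to one of `W`. -/
theorem exists_span_rep_eq_of_notMem [FiniteDimensional F V] {t : ℕ}
    {S : Set (Projectivization F V)} {W' W : Submodule F V} (hle : W' ≤ W)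
    (hW' : Module.finrank F W' = t) (hW : Module.finrank F W = t + 1)
    (h : ∃ p : Fin t → Projectivization F V, (∀ i, p i ∈ S) ∧
      Submodule.span F (Set.range fun i => (p i).rep) = W')
    {R : Projectivization F V} (hRS : R ∈ S) (hRW : R.rep ∈ W) (hRW' : R.rep ∉ W') :
    ∃ p : Fin (t + 1) → Projectivization F V, (∀ i, p i ∈ S) ∧
      Submodule.span F (Set.range fun i => (p i).rep) = W := by
  obtain ⟨p, hpS, rfl⟩ := h
  refine ⟨Fin.cons R p, Fin.cases hRS hpS, ?_⟩
  have hrange : (Set.range fun i => ((Fin.cons R p : Fin (t + 1) → _) i).rep) =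
      insert R.rep (Set.range fun i => (p i).rep) := by
    rw [← Fin.range_cons]
    congr 1
    funext i
    cases i using Fin.cases <;> rfl
  rw [hrange]
  have hlt : Submodule.span F (Set.range fun i => (p i).rep) <
      Submodule.span F (insert R.rep (Set.range fun i => (p i).rep)) :=
    lt_of_le_of_ne (Submodule.span_mono (Set.subset_insert _ _)) fun he =>
      hRW' (he ▸ Submodule.subset_span (Set.mem_insert _ _))
  have hfin := Submodule.finrank_lt_finrank_of_lt hlt
  refine Submodule.eq_of_le_of_finrank_le
    (Submodule.span_le.2 (Set.insert_subset hRW (Submodule.span_le.1 hle))) ?_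
  omega

/-- Every point of the span of `q` and `p` outside `H ∋ p` has a representative `q + c • p`. -/
theorem exists_eq_mk_add_smul {H : Submodule F V} {q p : V} (hp : p ∈ H)
    (hq : ∀ c : F, q + c • p ≠ 0) {X : Projectivization F V}
    (hX : X.rep ∈ Submodule.span F {q, p}) (hXH : X.rep ∉ H) :
    ∃ c : F, X = mk F (q + c • p) (hq c) := by
  obtain ⟨a, b, hab⟩ := Submodule.mem_span_pair.1 hX
  have ha : a ≠ 0 := by
    rintro rfl
    exact hXH (by rw [← hab, zero_smul, zero_add]; exact H.smul_mem b hp)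
  refine ⟨a⁻¹ * b, ?_⟩
  rw [← X.mk_rep, mk_eq_mk_iff']
  exact ⟨a, by rw [← hab, smul_add, smul_smul, mul_inv_cancel_left₀ ha]⟩

/-- Adding vectors of `H` to a vector outside `H` gives pairwise distinct points. -/
theorem mk_add_injOn {H : Submodule F V} {q : V} (hq : q ∉ H) {x y : V} (hx : x ∈ H) (hy : y ∈ H)
    {hqx : q + x ≠ 0} {hqy : q + y ≠ 0} (h : mk F (q + x) hqx = mk F (q + y) hqy) : x = y := by
  obtain ⟨a, ha⟩ := (mk_eq_mk_iff' F _ _ hqx hqy).1 h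
  have hmem : (a - 1) • q ∈ H := by
    have : (a - 1) • q = x - a • y := by
      rw [sub_smul, one_smul, sub_eq_sub_iff_add_eq_add, ← smul_add, ha, add_comm]
    rw [this]
    exact H.sub_mem hx (H.smul_mem a hy)
  obtain rfl : a = 1 := by
    by_contra hne
    exact hq ((H.smul_mem_iff (sub_ne_zero.2 hne)).1 hmem)
  rw [one_smul] at ha
  exact (add_left_cancel ha).symm

end Projectivization

/-- The union of `n` affine lines `q + F • p i` with independent directions has
`1 + n (|F| - 1)` elements in the projective space. -/
theorem Projectivization.ncard_iUnion_mk_add_smul {F V ι : Type*} [Field F] [Fintype F]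
    [AddCommGroup V] [Module F V] [Fintype ι] [Nonempty ι] {H : Submodule F V} {q : V}
    (hq : q ∉ H) {p : ι → V} (hp : ∀ i, p i ∈ H) (hind : LinearIndependent F p)
    (hne : ∀ i (c : F), q + c • p i ≠ 0) :
    (⋃ i, Set.range fun c : F => mk F (q + c • p i) (hne i c)).ncard =
      1 + Fintype.card ι * (Fintype.card F - 1) := by
  classical
  let g : Option (ι × Fˣ) → V := fun o => o.elim 0 fun x => (x.2 : F) • p x.1
  have hgH : ∀ o, g o ∈ H := by
    rintro (_ | ⟨i, c⟩)
    exacts [H.zero_mem, H.smul_mem _ (hp i)]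
  have hg : Function.Injective g := by
    have hnz : ∀ i (c : Fˣ), (c : F) • p i ≠ 0 := fun i c =>
      smul_ne_zero c.ne_zero (hind.ne_zero i)
    rintro (_ | ⟨i, c⟩) (_ | ⟨j, d⟩) h
    · rfl
    · exact absurd h.symm (hnz j d)
    · exact absurd h (hnz i c)
    · have h' : (c : F) • p i = (d : F) • p j := h
      obtain rfl : i = j := by
        have hs : Finsupp.single i (c : F) = Finsupp.single j (d : F) :=
          hind (by simpa [Finsupp.linearCombination_single] using h')
        rcases (Finsupp.single_eq_single_iff _ _ _ _).1 hs with h | h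
        exacts [h.1, absurd h.1 c.ne_zero]
      rw [Units.ext (smul_left_injective F (hind.ne_zero i) h')]
  have hg0 : ∀ o, q + g o ≠ 0 := fun o h =>
    hq (by rw [eq_neg_of_add_eq_zero_left h]; exact H.neg_mem (hgH o))
  have hrange : (⋃ i, Set.range fun c : F => mk F (q + c • p i) (hne i c)) =
      Set.range fun o => mk F (q + g o) (hg0 o) := by
    ext X
    simp only [Set.mem_iUnion, Set.mem_range]
    constructor
    · rintro ⟨i, c, rfl⟩
      by_cases hc : c = 0
      · subst hc
        exact ⟨none, by simp [g]⟩
      · exact ⟨some (i, Units.mk0 c hc), rfl⟩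
    · rintro ⟨_ | ⟨i, c⟩, rfl⟩
      · exact ⟨Classical.arbitrary ι, 0, by simp [g]⟩
      · exact ⟨i, c, rfl⟩
  rw [hrange, ← Nat.card_coe_set_eq, Nat.card_range_of_injective fun o o' h =>
    hg (mk_add_injOn hq (hgH o) (hgH o') h), Nat.card_eq_fintype_card, Fintype.card_option,
    Fintype.card_prod, Fintype.card_units, add_comm]

/-- Theorem 10, Construction A. From a `v`-fold strong blocking set `B`
of a hyperplane `H ≅ PG(v,q)` of `PG(v+1,q)` of size `k`, together with `v+1` projectively
independent points `P i` of `H` and concurrent lines `l i` with `l i ∩ H = {P i}`, one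
obtains the `(v+1)`-fold strong blocking set `B* = B ∪ ⋃ i, (l i \ {P i})` of
`PG(v+1,q)`, of size `k + 1 + (v+1)(q-1)`. -/
theorem statement6 (F : Type*) [Field F] [Fintype F] (v k : ℕ) (hv : 2 ≤ v)
    (H : Submodule F (Fin (v + 2) → F)) (hH : Module.finrank F H = v + 1)
    (B : Set (Projectivization F (Fin (v + 2) → F)))
    (hBH : ∀ P ∈ B, Projectivization.rep P ∈ H)
    (hBcard : B.ncard = k)
    (hBblock : ∀ W : Submodule F (Fin (v + 2) → F), W ≤ H → Module.finrank F W = v →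
      ∃ p : Fin v → Projectivization F (Fin (v + 2) → F),
        (∀ i, p i ∈ B) ∧
          Submodule.span F (Set.range (fun i => (p i).rep)) = W)
    (P : Fin (v + 1) → Projectivization F (Fin (v + 2) → F))
    (hPH : ∀ i, (P i).rep ∈ H)
    (hPind : LinearIndependent F (fun i => (P i).rep))
    (l : Fin (v + 1) → Set (Projectivization F (Fin (v + 2) → F)))
    (hline : ∀ i, ∃ W : Submodule F (Fin (v + 2) → F), Module.finrank F W = 2 ∧
      l i = {Q : Projectivization F (Fin (v + 2) → F) | Q.rep ∈ W})
    (hconc : ∃ Q, ∀ i, Q ∈ l i)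
    (hlH : ∀ i, l i ∩ {Q : Projectivization F (Fin (v + 2) → F) | Q.rep ∈ H} = {P i}) :
    IsStrongBlocking F (v + 2) (v + 1) (B ∪ ⋃ i, (l i \ {P i})) ∧
      (B ∪ ⋃ i, (l i \ {P i})).ncard = k + 1 + (v + 1) * (Fintype.card F - 1) := by
  have hmemB : ∀ i, ∀ X ∈ l i \ {P i}, X.rep ∉ H := fun i X hX hXH =>
    hX.2 (hlH i ▸ ⟨hX.1, hXH⟩)
  have hPl : ∀ i, P i ∈ l i := fun i =>
    ((hlH i).symm ▸ Set.mem_singleton (P i) : P i ∈ l i ∩ {Q | Q.rep ∈ H}).1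
  constructor
  · intro W hW
    by_cases hWH : W = H
    · subst hWH
      have hsub : ∀ f : Fin v → Fin (v + 1), Function.Injective f →
          Submodule.span F (Set.range fun i => (P (f i)).rep) ≤ W ∧
          Module.finrank F (Submodule.span F (Set.range fun i => (P (f i)).rep)) = v :=
        fun f hf => ⟨Submodule.span_le.2 (Set.range_subset_iff.2 fun i => hPH _),
          by simpa [Function.comp_def] using finrank_span_eq_card (hPind.comp f hf)⟩
      obtain ⟨hle, hfin⟩ := hsub Fin.castSucc (Fin.castSucc_injective v)
      obtain ⟨hle', hfin'⟩ := hsub Fin.succ (Fin.succ_injective v)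
      obtain ⟨p, hpB, hp⟩ := hBblock _ hle' hfin'
      have hlast : (P (Fin.last v)).rep ∉
          Submodule.span F (Set.range fun i : Fin v => (P i.castSucc).rep) := by
        have h := hPind.notMem_span_image (s := Set.range Fin.castSucc) (x := Fin.last v)
          (by rintro ⟨i, hi⟩; exact Fin.castSucc_ne_last i hi)
        rwa [← Set.range_comp] at h
      obtain ⟨i, hi⟩ : ∃ i, (p i).rep ∉
          Submodule.span F (Set.range fun i : Fin v => (P i.castSucc).rep) := by
        by_contra! hall
        refine hlast (Submodule.span_le.2 (Set.range_subset_iff.2 hall) ?_)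
        rw [hp]
        have hsucc : Fin.succ (⟨v - 1, by omega⟩ : Fin v) = Fin.last v :=
          Fin.ext (by simp only [Fin.val_succ, Fin.val_last]; omega)
        exact Submodule.subset_span ⟨_, congrArg (fun j => (P j).rep) hsucc⟩
      obtain ⟨p', hp'B, hp'⟩ := hBblock _ hle hfin
      exact Projectivization.exists_span_rep_eq_of_notMem hle hfin hW
        ⟨p', fun i => Or.inl (hp'B i), hp'⟩ (Or.inl (hpB i)) (hBH _ (hpB i)) hi
    · obtain ⟨i, hi⟩ : ∃ i, (P i).rep ∉ W := by
        by_contra! hall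
        have hspan : Module.finrank F
            (Submodule.span F (Set.range fun i => (P i).rep)) = v + 1 := by
          simpa using finrank_span_eq_card hPind
        have hW' := Submodule.eq_of_le_of_finrank_le
          (Submodule.span_le.2 (Set.range_subset_iff.2 hall)) (hW.trans hspan.symm).le
        have hH' := Submodule.eq_of_le_of_finrank_le
          (Submodule.span_le.2 (Set.range_subset_iff.2 hPH)) (hH.trans hspan.symm).le
        exact hWH (hW'.symm.trans hH')
      obtain ⟨L, hL, hlL⟩ := hline i
      obtain ⟨x, hx, hx0⟩ : ∃ x ∈ L ⊓ W, x ≠ 0 := by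
        refine Submodule.exists_mem_ne_zero_of_ne_bot fun hbot => ?_
        have h1 := Submodule.finrank_sup_add_finrank_inf_eq L W
        have h2 := Submodule.finrank_le (L ⊔ W)
        rw [hbot, finrank_bot] at h1
        rw [Module.finrank_fin_fun] at h2
        omega
      have hRW := (Projectivization.rep_mk_mem_iff W hx0).2 hx.2
      have hR : Projectivization.mk F x hx0 ∈ l i \ {P i} := by
        refine ⟨hlL ▸ (Projectivization.rep_mk_mem_iff L hx0).2 hx.1, ?_⟩
        intro h
        exact hi (Set.mem_singleton_iff.1 h ▸ hRW)
      have hRH := hmemB i _ hR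
      have hfin : Module.finrank F (W ⊓ H : Submodule F (Fin (v + 2) → F)) = v := by
        have h1 := Submodule.finrank_sup_add_finrank_inf_eq W H
        have h2 := Submodule.finrank_le (W ⊔ H)
        rw [Module.finrank_fin_fun] at h2
        have h3 : W ⊓ H < W := lt_of_le_of_ne inf_le_left fun he =>
          hRH (inf_eq_left.1 he hRW)
        have h4 := Submodule.finrank_lt_finrank_of_lt h3
        omega
      obtain ⟨p, hpB, hp⟩ := hBblock _ inf_le_right hfin
      exact Projectivization.exists_span_rep_eq_of_notMem inf_le_left hfin hW
        ⟨p, fun i => Or.inl (hpB i), hp⟩ (Or.inr (Set.mem_iUnion.2 ⟨i, hR⟩)) hRW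
        fun h => hRH h.2
  · obtain ⟨Q, hQ⟩ := hconc
    have hQH : Q.rep ∉ H := by
      intro hQH
      have hQP : ∀ i, Q = P i := fun i =>
        (hlH i ▸ ⟨hQ i, hQH⟩ : Q ∈ ({P i} : Set _))
      have h01 : (0 : Fin (v + 1)) = Fin.last v :=
        hPind.injective (congrArg Projectivization.rep ((hQP 0).symm.trans (hQP _)))
      have := congrArg Fin.val h01
      simp only [Fin.val_zero, Fin.val_last] at this
      omega
    have hnotMem : ∀ i (c : F), Q.rep + c • (P i).rep ∉ H := fun i c h =>
      hQH ((H.add_mem_iff_left (H.smul_mem c (hPH i))).1 h)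
    have hne : ∀ i (c : F), Q.rep + c • (P i).rep ≠ 0 := fun i c h =>
      hnotMem i c (h ▸ H.zero_mem)
    have hl : ∀ i, l i \ {P i} =
        Set.range fun c : F => Projectivization.mk F (Q.rep + c • (P i).rep) (hne i c) := by
      intro i
      obtain ⟨L, hL, hlL⟩ := hline i
      have hQL : Q.rep ∈ L := by simpa [hlL] using hQ i
      have hPL : (P i).rep ∈ L := by simpa [hlL] using hPl i
      have hspan : Submodule.span F {Q.rep, (P i).rep} = L := by
        refine Submodule.eq_of_le_of_finrank_le
          (Submodule.span_le.2 (Set.insert_subset hQL (Set.singleton_subset_iff.2 hPL))) ?_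
        have hlt : Submodule.span F {(P i).rep} < Submodule.span F {Q.rep, (P i).rep} :=
          lt_of_le_of_ne (Submodule.span_mono (Set.subset_insert _ _)) fun he =>
            hQH ((Submodule.span_singleton_le_iff_mem _ _).2 (hPH i)
              (he ▸ Submodule.subset_span (Set.mem_insert _ _)))
        have h1 := Submodule.finrank_lt_finrank_of_lt hlt
        rw [finrank_span_singleton (P i).rep_nonzero] at h1
        omega
      ext X
      constructor
      · intro hX
        obtain ⟨c, hc⟩ := Projectivization.exists_eq_mk_add_smul (hPH i) (hne i) (X := X)
          (by simpa [hspan, hlL] using hX.1) (hmemB i X hX)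
        exact ⟨c, hc.symm⟩
      · rintro ⟨c, rfl⟩
        refine ⟨hlL ▸ (Projectivization.rep_mk_mem_iff L _).2
          (L.add_mem hQL (L.smul_mem c hPL)), fun h => hnotMem i c ?_⟩
        have hX : Projectivization.mk F (Q.rep + c • (P i).rep) (hne i c) = P i := h
        rw [← Projectivization.rep_mk_mem_iff H (hne i c), hX]
        exact hPH i
    have hdisj : Disjoint B (⋃ i, (l i \ {P i})) := by
      refine Set.disjoint_left.2 fun X hXB hX => ?_
      obtain ⟨i, hi⟩ := Set.mem_iUnion.1 hX
      exact hmemB i X hi (hBH X hXB)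
    rw [Set.ncard_union_eq hdisj (Set.toFinite _) (Set.toFinite _), hBcard, Set.iUnion_congr hl,
      Projectivization.ncard_iUnion_mk_add_smul hQH hPH hPind hne, Fintype.card_fin, add_assoc]
end
end

section
/- For every prime power q and every integer v ≥ 3, the space PG(v,q) contains a v-fold strong blocking set of size (q−1)·(v(v+1)/2 − 2) + v + 5. -/
noncomputable section

/-- If `S` is closed under scalar multiplication, then the number of vectors of `S` is determined
by the number of projective points represented in `S`. -/
theorem ncard_cone_eq {F V : Type*} [Field F] [Fintype F] [AddCommGroup V] [Module F V] [Finite V]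
    (S : Set V) (h0 : (0 : V) ∈ S) (hS : ∀ (a : F), ∀ x ∈ S, a • x ∈ S) :
    S.ncard = (Fintype.card F - 1) * {P : Projectivization F V | P.rep ∈ S}.ncard + 1 := by
  classical
  set B := {P : Projectivization F V | P.rep ∈ S} with hB
  have hne : S \ {0} =
      (fun z : Fˣ × Projectivization F V => z.1 • z.2.rep) '' (Set.univ ×ˢ B) := by
    ext x
    constructor
    · rintro ⟨hx, hx0⟩
      have hx0 : x ≠ 0 := hx0
      obtain ⟨a, ha⟩ := Projectivization.exists_smul_eq_mk_rep F x hx0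
      refine ⟨(a⁻¹, Projectivization.mk F x hx0), ⟨trivial, ?_⟩, ?_⟩
      · change (Projectivization.mk F x hx0).rep ∈ S
        rw [← ha]
        exact hS (a : F) x hx
      · simp only [← ha, inv_smul_smul]
    · rintro ⟨⟨a, P⟩, ⟨-, hP⟩, rfl⟩
      refine ⟨hS (a : F) _ hP, ?_⟩
      simpa [Units.smul_def] using P.rep_nonzero
  have hinj : Function.Injective (fun z : Fˣ × Projectivization F V => z.1 • z.2.rep) := by
    rintro ⟨a, P⟩ ⟨b, Q⟩ h
    simp only at h
    have hPQ : P = Q := by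
      rw [← P.mk_rep, ← Q.mk_rep, Projectivization.mk_eq_mk_iff]
      exact ⟨a⁻¹ * b, by rw [mul_smul, ← h, inv_smul_smul]⟩
    subst hPQ
    have : (a : F) = b := smul_left_injective F P.rep_nonzero h
    rw [Units.ext this]
  rw [← Set.ncard_sdiff_singleton_add_one h0 (Set.toFinite _), hne,
    Set.ncard_image_of_injective _ hinj, Set.ncard_prod, Set.ncard_univ, Nat.card_eq_fintype_card,
    Fintype.card_units]

/-- A cone whose trace on each hyperplane spans that hyperplane gives a strong blocking set. -/
theorem isStrongBlocking_of_ker_le_span {F : Type*} [Field F] {v : ℕ} (S : Set (Fin (v + 1) → F))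
    (hS : ∀ (a : F), ∀ x ∈ S, a • x ∈ S)
    (hker : ∀ f : (Fin (v + 1) → F) →ₗ[F] F,
      LinearMap.ker f ≤ Submodule.span F (S ∩ LinearMap.ker f)) :
    IsStrongBlocking F (v + 1) v {P | P.rep ∈ S} := by
  intro W hW
  have hlt : W < ⊤ := by
    refine lt_top_iff_ne_top.2 fun h => ?_
    rw [h, finrank_top, Module.finrank_fin_fun] at hW
    omega
  obtain ⟨f, hf0, hf⟩ := Submodule.exists_le_ker_of_lt_top W hlt
  have hWf : W = LinearMap.ker f := by
    refine Submodule.eq_of_le_of_finrank_le hf ?_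
    have := Submodule.finrank_lt fun h => hf0 (LinearMap.ker_eq_top.1 h)
    rw [Module.finrank_fin_fun] at this
    omega
  have hspan : Submodule.span F ((fun P : Projectivization F (Fin (v + 1) → F) => P.rep) ''
      {P | P.rep ∈ S ∧ P.rep ∈ W}) = W := by
    refine le_antisymm (Submodule.span_le.2 ?_) ?_
    · rintro _ ⟨P, ⟨-, hP⟩, rfl⟩
      exact hP
    · conv_lhs => rw [hWf]
      refine (hker f).trans (Submodule.span_le.2 ?_)
      rintro x ⟨hxS, hxf⟩
      by_cases hx0 : x = 0
      · rw [hx0]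
        exact Submodule.zero_mem _
      obtain ⟨a, ha⟩ := Projectivization.exists_smul_eq_mk_rep F x hx0
      have hx : x = (a⁻¹ : Fˣ) • (Projectivization.mk F x hx0).rep := by
        rw [← ha, inv_smul_smul]
      rw [hx]
      refine Submodule.smul_mem _ ((a⁻¹ : Fˣ) : F) (Submodule.subset_span ⟨_, ⟨?_, ?_⟩, rfl⟩)
      · rw [← ha]
        exact hS (a : F) x hxS
      · rw [← ha, hWf]
        exact Submodule.smul_mem _ (a : F) hxf
  obtain ⟨g, hg, hgs, -⟩ := Submodule.exists_fun_fin_finrank_span_eq F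
    ((fun P : Projectivization F (Fin (v + 1) → F) => P.rep) '' {P | P.rep ∈ S ∧ P.rep ∈ W})
  replace hgs := hgs.trans hspan
  have hfr : v = Module.finrank F (Submodule.span F
      ((fun P : Projectivization F (Fin (v + 1) → F) => P.rep) ''
        {P | P.rep ∈ S ∧ P.rep ∈ W})) := by rw [hspan, hW]
  choose p hp hpg using hg
  refine ⟨fun i => p (Fin.cast hfr i), fun i => (hp _).1, ?_⟩
  refine Eq.trans (congrArg (Submodule.span F) ?_) hgs
  ext x
  constructor
  · rintro ⟨i, rfl⟩
    exact ⟨Fin.cast hfr i, (hpg _).symm⟩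
  · rintro ⟨i, rfl⟩
    exact ⟨Fin.cast hfr.symm i, hpg i⟩

/-- The inductive construction: join a new vertex to the coordinate vectors of a cone `S`. -/
def coneJoin {F : Type*} [Field F] {n : ℕ} (S : Set (Fin n → F)) : Set (Fin (n + 1) → F) :=
  {x | x 0 = 0 ∧ Fin.tail x ∈ S ∨
    x 0 ≠ 0 ∧ (Fin.tail x = 0 ∨ ∃ i, ∃ c : F, c ≠ 0 ∧ Fin.tail x = Pi.single i c)}

theorem ncard_coneJoin {F : Type*} [Field F] [Fintype F] {n : ℕ} (S : Set (Fin n → F)) :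
    (coneJoin S).ncard =
      S.ncard + (Fintype.card F - 1) * ((Fintype.card F - 1) * n + 1) := by
  classical
  let φ : Fˣ × Option (Fˣ × Fin n) → (Fin (n + 1) → F) := fun z =>
    Fin.cons (z.1 : F) (z.2.elim 0 fun w => Pi.single w.2 (w.1 : F))
  have hφ : Function.Injective φ := by
    rintro ⟨a, o⟩ ⟨a', o'⟩ h
    obtain ⟨h1, h2⟩ := Fin.cons_inj.1 h
    have ha : a = a' := Units.ext h1
    subst ha
    congr 1
    rcases o with _ | ⟨c, i⟩ <;> rcases o' with _ | ⟨c', i'⟩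
    · rfl
    · exact absurd (by simpa using congrFun h2 i') c'.ne_zero.symm
    · exact absurd (by simpa using congrFun h2 i) c.ne_zero
    · have h3 : (Pi.single i (c : F) : Fin n → F) = Pi.single i' (c' : F) := h2
      have hi : i = i' := by
        by_contra hne
        have := congrFun h3 i
        rw [Pi.single_eq_same, Pi.single_eq_of_ne hne] at this
        exact c.ne_zero this
      subst hi
      rw [Units.ext (Pi.single_injective i h3)]
  have hψ : Function.Injective (fun y : Fin n → F => (Fin.cons 0 y : Fin (n + 1) → F)) :=
    Fin.cons_right_injective (α := fun _ => F) 0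
  have hun : coneJoin S = (fun y : Fin n → F => (Fin.cons 0 y : Fin (n + 1) → F)) '' S ∪
      Set.range φ := by
    ext x
    constructor
    · rintro (⟨h0, hx⟩ | ⟨h0, hx | ⟨i, c, hc, hx⟩⟩)
      · exact Or.inl ⟨_, hx, by simp only [← h0, Fin.cons_self_tail]⟩
      · refine Or.inr ⟨(Units.mk0 _ h0, none), ?_⟩
        change (Fin.cons (x 0) (0 : Fin n → F) : Fin (n + 1) → F) = x
        rw [← hx, Fin.cons_self_tail]
      · refine Or.inr ⟨(Units.mk0 _ h0, some (Units.mk0 c hc, i)), ?_⟩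
        change (Fin.cons (x 0) (Pi.single i c : Fin n → F) : Fin (n + 1) → F) = x
        rw [← hx, Fin.cons_self_tail]
    · rintro (⟨y, hy, rfl⟩ | ⟨⟨a, _ | ⟨c, i⟩⟩, rfl⟩)
      · exact Or.inl ⟨rfl, hy⟩
      · exact Or.inr ⟨a.ne_zero, Or.inl rfl⟩
      · exact Or.inr ⟨a.ne_zero, Or.inr ⟨i, c, c.ne_zero, rfl⟩⟩
  have hdisj : Disjoint ((fun y : Fin n → F => (Fin.cons 0 y : Fin (n + 1) → F)) '' S)
      (Set.range φ) := by
    rw [Set.disjoint_left]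
    rintro _ ⟨y, -, rfl⟩ ⟨z, hz⟩
    exact z.1.ne_zero (congrFun hz 0)
  rw [hun, Set.ncard_union_eq hdisj (Set.toFinite _) (Set.toFinite _),
    Set.ncard_image_of_injective _ hψ, ← Set.image_univ, Set.ncard_image_of_injective _ hφ,
    Set.ncard_univ, Nat.card_eq_fintype_card]
  simp [Fintype.card_prod, Fintype.card_option, Fintype.card_units]

theorem smul_mem_coneJoin {F : Type*} [Field F] {n : ℕ} {S : Set (Fin n → F)}
    (h0 : (0 : Fin n → F) ∈ S) (hS : ∀ (a : F), ∀ x ∈ S, a • x ∈ S) (a : F)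
    (x : Fin (n + 1) → F) (hx : x ∈ coneJoin S) : a • x ∈ coneJoin S := by
  by_cases ha : a = 0
  · subst ha
    refine Or.inl ⟨by simp, ?_⟩
    have : Fin.tail ((0 : F) • x) = 0 := by
      ext i
      simp [Fin.tail]
    rw [this]
    exact h0
  have ht : Fin.tail (a • x) = a • Fin.tail x := rfl
  rcases hx with ⟨hx0, hx⟩ | ⟨hx0, hx | ⟨i, c, hc, hx⟩⟩
  · exact Or.inl ⟨by simp [hx0], ht ▸ hS a _ hx⟩
  · exact Or.inr ⟨by simp [hx0, ha], Or.inl (by rw [ht, hx, smul_zero])⟩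
  · refine Or.inr ⟨by simp [hx0, ha], Or.inr ⟨i, a * c, mul_ne_zero ha hc, ?_⟩⟩
    rw [ht, hx, ← smul_eq_mul, Pi.single_smul]

theorem ker_le_span_coneJoin {F : Type*} [Field F] {n : ℕ} {S : Set (Fin n → F)}
    (hker : ∀ f : (Fin n → F) →ₗ[F] F,
      LinearMap.ker f ≤ Submodule.span F (S ∩ LinearMap.ker f))
    (f : (Fin (n + 1) → F) →ₗ[F] F) :
    LinearMap.ker f ≤ Submodule.span F (coneJoin S ∩ LinearMap.ker f) := by
  let ι : (Fin n → F) →ₗ[F] (Fin (n + 1) → F) :=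
    { toFun := fun y => Fin.cons 0 y
      map_add' := fun y z => by
        ext i
        refine Fin.cases ?_ (fun j => ?_) i <;> simp
      map_smul' := fun a y => by
        ext i
        refine Fin.cases ?_ (fun j => ?_) i <;> simp }
  let P : Fin (n + 1) → F := Fin.cons 1 0
  have hdec : ∀ x : Fin (n + 1) → F, x = x 0 • P + ι (Fin.tail x) := by
    intro x
    ext i
    refine Fin.cases ?_ (fun j => ?_) i <;> simp [P, ι, Fin.tail]
  have hι : ∀ y, f (ι y) = 0 → ι y ∈ Submodule.span F (coneJoin S ∩ LinearMap.ker f) := by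
    intro y hy
    have h1 : y ∈ Submodule.span F (S ∩ LinearMap.ker (f ∘ₗ ι)) := hker (f ∘ₗ ι) hy
    have h2 := Submodule.mem_map_of_mem (f := ι) h1
    rw [Submodule.map_span] at h2
    refine Submodule.span_mono ?_ h2
    rintro _ ⟨z, ⟨hz, hzf⟩, rfl⟩
    exact ⟨Or.inl ⟨rfl, hz⟩, hzf⟩
  intro x hx
  have hfx : x 0 * f P + f (ι (Fin.tail x)) = 0 := by
    have : f x = 0 := hx
    rw [hdec x, map_add, map_smul, smul_eq_mul] at this
    exact this
  by_cases hP : f P = 0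
  · rw [hdec x]
    refine Submodule.add_mem _ (Submodule.smul_mem _ _ (Submodule.subset_span ⟨?_, hP⟩)) (hι _ ?_)
    · exact Or.inr ⟨one_ne_zero, Or.inl rfl⟩
    · simpa [hP] using hfx
  by_cases hg : f ∘ₗ ι = 0
  · have hg' : ∀ y, f (ι y) = 0 := fun y => LinearMap.congr_fun hg y
    have hx0 : x 0 = 0 := by simpa [hg', hP] using hfx
    rw [hdec x, hx0, zero_smul, zero_add]
    exact hι _ (hg' _)
  · obtain ⟨i, hi⟩ : ∃ i, f (ι (Pi.single i 1)) ≠ 0 := by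
      by_contra! h
      refine hg ((Pi.basisFun F (Fin n)).ext fun i => ?_)
      simpa using h i
    set c : F := -f P / f (ι (Pi.single i 1)) with hc
    have hs : (Pi.single i c : Fin n → F) = c • Pi.single i 1 := by
      rw [← Pi.single_smul, smul_eq_mul, mul_one]
    have hz : f (P + ι (Pi.single i c)) = 0 := by
      rw [map_add, hs, map_smul, map_smul, smul_eq_mul, hc]
      field_simp
      ring
    have hx' : x = x 0 • (P + ι (Pi.single i c)) + ι (Fin.tail x - x 0 • Pi.single i c) := by
      conv_lhs => rw [hdec x]
      rw [map_sub, map_smul, smul_add]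
      abel
    have hrem : f (ι (Fin.tail x - x 0 • Pi.single i c)) = 0 := by
      have : f x = 0 := hx
      rwa [hx', map_add, map_smul, hz, smul_zero, zero_add] at this
    rw [hx']
    refine Submodule.add_mem _ (Submodule.smul_mem _ _ (Submodule.subset_span ⟨?_, hz⟩))
      (hι _ hrem)
    refine Or.inr ⟨by simp [P, ι], Or.inr ⟨i, c, ?_, ?_⟩⟩
    · exact div_ne_zero (neg_ne_zero.2 hP) hi
    · ext j
      simp [P, ι, Fin.tail]

/-- A finite field contains an element not of the form `x ^ 2 - x`. -/
theorem exists_forall_sq_sub_self_ne (F : Type*) [Field F] [Finite F] :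
    ∃ d : F, ∀ x : F, x ^ 2 - x ≠ d := by
  by_contra! h
  have hs : Function.Surjective (fun x : F => x ^ 2 - x) := h
  exact zero_ne_one (Finite.injective_iff_surjective.2 hs (by simp : (0 : F) ^ 2 - 0 = 1 ^ 2 - 1))

/-- Three lines of a regulus of `PG(3, F)`, together with a fourth line. It is disjoint from
the quadric containing the regulus when `X ^ 2 - X - d` has no root. -/
def fourLines {F : Type*} [Field F] (d : F) : Set (Fin 4 → F) :=
  Set.range (fun z : F × F => ![z.1, z.2, 0, 0]) ∪ Set.range (fun z : F × F => ![0, 0, z.1, z.2]) ∪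
    Set.range (fun z : F × F => ![z.1, z.2, z.1, z.2]) ∪
    Set.range (fun z : F × F => ![z.1, z.2, d * z.2, z.1 + z.2])

theorem smul_mem_fourLines {F : Type*} [Field F] (d a : F) (x : Fin 4 → F)
    (hx : x ∈ fourLines d) : a • x ∈ fourLines d := by
  rcases hx with ((⟨z, rfl⟩ | ⟨z, rfl⟩) | ⟨z, rfl⟩) | ⟨z, rfl⟩
  · exact Or.inl (Or.inl (Or.inl ⟨a • z, by simp⟩))
  · exact Or.inl (Or.inl (Or.inr ⟨a • z, by simp⟩))
  · exact Or.inl (Or.inr ⟨a • z, by simp⟩)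
  · exact Or.inr ⟨a • z, by simp [mul_add, mul_left_comm]⟩

theorem ne_zero_of_forall_sq_sub_self_ne {F : Type*} [Field F] {d : F}
    (hd : ∀ x : F, x ^ 2 - x ≠ d) {a b : F} (h : d * a ^ 2 + a * b - b ^ 2 = 0) :
    a = 0 ∧ b = 0 := by
  by_cases ha : a = 0
  · subst ha
    exact ⟨rfl, by simpa using h⟩
  · refine absurd ?_ (hd (b / a))
    field_simp
    linear_combination -h

theorem ncard_fourLines {F : Type*} [Field F] [Fintype F] {d : F} (hd : ∀ x : F, x ^ 2 - x ≠ d) :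
    (fourLines d).ncard = 4 * (Fintype.card F ^ 2 - 1) + 1 := by
  classical
  have hd0 : d ≠ 0 := fun h => hd 0 (by simp [h])
  let φ : Fin 4 → F × F → (Fin 4 → F) := ![fun z => ![z.1, z.2, 0, 0], fun z => ![0, 0, z.1, z.2],
    fun z => ![z.1, z.2, z.1, z.2], fun z => ![z.1, z.2, d * z.2, z.1 + z.2]]
  have h0 : (0 : Fin 4 → F) ∈ fourLines d :=
    Or.inl (Or.inl (Or.inl ⟨0, by ext i; fin_cases i <;> rfl⟩))
  have hφ0 : ∀ i z, φ i z = 0 → z = 0 := by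
    rintro i ⟨a, b⟩ h
    have e0 := congrFun h 0
    have e1 := congrFun h 1
    have e2 := congrFun h 2
    have e3 := congrFun h 3
    fin_cases i <;> simp_all [φ]
  have hφ00 : ∀ i, φ i 0 = 0 := by
    intro i
    ext j
    fin_cases i <;> fin_cases j <;> simp [φ]
  have hφ : Function.Injective (fun w : Fin 4 × {z : F × F // z ≠ 0} => φ w.1 w.2) := by
    rintro ⟨i, ⟨⟨a, b⟩, hab⟩⟩ ⟨j, ⟨⟨a', b'⟩, hab'⟩⟩ h
    have e0 := congrFun h 0
    have e1 := congrFun h 1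
    have e2 := congrFun h 2
    have e3 := congrFun h 3
    have hab : a = 0 → b ≠ 0 := fun h h' => hab (Prod.ext h h')
    have hab' : a' = 0 → b' ≠ 0 := fun h h' => hab' (Prod.ext h h')
    clear h
    fin_cases i <;> fin_cases j <;> simp [φ] at e0 e1 e2 e3 ⊢ <;> grind
  have hmem : ∀ x, x ∈ fourLines d ↔ ∃ i z, φ i z = x := by
    intro x
    simp [fourLines, φ, Fin.exists_fin_succ, or_assoc]
  have hne : fourLines d \ {0} =
      Set.range (fun w : Fin 4 × {z : F × F // z ≠ 0} => φ w.1 w.2) := by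
    ext x
    constructor
    · rintro ⟨hx, hx0⟩
      obtain ⟨i, z, rfl⟩ := (hmem x).1 hx
      exact ⟨(i, ⟨z, fun h => hx0 (h ▸ hφ00 i)⟩), rfl⟩
    · rintro ⟨⟨i, z⟩, rfl⟩
      exact ⟨(hmem _).2 ⟨i, z, rfl⟩, fun h => z.2 (hφ0 i z h)⟩
  rw [← Set.ncard_sdiff_singleton_add_one h0 (Set.toFinite _), hne, ← Set.image_univ,
    Set.ncard_image_of_injective _ hφ, Set.ncard_univ, Nat.card_eq_fintype_card,
    Fintype.card_prod, Fintype.card_subtype_compl, Fintype.card_fin, Fintype.card_subtype_eq,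
    Fintype.card_prod, sq]

theorem ker_le_span_fourLines {F : Type*} [Field F] {d : F} (hd : ∀ x : F, x ^ 2 - x ≠ d)
    (f : (Fin 4 → F) →ₗ[F] F) :
    LinearMap.ker f ≤ Submodule.span F (fourLines d ∩ LinearMap.ker f) := by
  obtain ⟨a, ha⟩ : ∃ a : Fin 4 → F, ∀ x, f x = x 0 * a 0 + x 1 * a 1 + x 2 * a 2 + x 3 * a 3 := by
    refine ⟨fun i => f (Pi.single i 1), fun x => ?_⟩
    conv_lhs => rw [← (Pi.basisFun F (Fin 4)).sum_repr x]
    simp [Fin.sum_univ_four]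
  set N := Submodule.span F (fourLines d ∩ LinearMap.ker f) with hN
  have h1 : ∀ p q, p * a 0 + q * a 1 = 0 → ![p, q, 0, 0] ∈ N := fun p q h =>
    Submodule.subset_span ⟨Or.inl (Or.inl (Or.inl ⟨(p, q), rfl⟩)), by simp [ha, h]⟩
  have h2 : ∀ p q, p * a 2 + q * a 3 = 0 → ![0, 0, p, q] ∈ N := fun p q h =>
    Submodule.subset_span ⟨Or.inl (Or.inl (Or.inr ⟨(p, q), rfl⟩)), by simp [ha, h]⟩
  intro x hx
  have hfx : f x = 0 := hx
  rw [ha] at hfx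
  have hsplit : ∀ y : Fin 4 → F, y 0 * a 0 + y 1 * a 1 = 0 → y 2 * a 2 + y 3 * a 3 = 0 →
      y ∈ N := by
    intro y hy hy'
    have : y = ![y 0, y 1, 0, 0] + ![0, 0, y 2, y 3] := by
      ext i
      fin_cases i <;> simp
    rw [this]
    exact N.add_mem (h1 _ _ hy) (h2 _ _ hy')
  by_cases hα : a 0 = 0 ∧ a 1 = 0
  · obtain ⟨hα0, hα1⟩ := hα
    refine hsplit x (by simp [hα0, hα1]) ?_
    simpa [hα0, hα1] using hfx
  by_cases hβ : a 2 = 0 ∧ a 3 = 0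
  · obtain ⟨hβ0, hβ1⟩ := hβ
    refine hsplit x ?_ (by simp [hβ0, hβ1])
    simpa [hβ0, hβ1] using hfx
  obtain ⟨y, hy, hyf, hy0⟩ : ∃ y ∈ fourLines d, f y = 0 ∧ y 0 * a 0 + y 1 * a 1 ≠ 0 := by
    by_cases hD : a 0 * a 3 - a 1 * a 2 = 0
    · refine ⟨![a 1 + d * a 2 + a 3, -(a 0 + a 3), d * -(a 0 + a 3),
        a 1 + d * a 2 + a 3 + -(a 0 + a 3)], Or.inr ⟨(_, _), rfl⟩, ?_, ?_⟩
      · simp only [ha, Matrix.cons_val]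
        ring
      · intro h
        simp only [Matrix.cons_val] at h
        have hq : d * (a 0 * a 2) + a 0 * a 3 - a 1 * a 3 = 0 := by linear_combination h
        by_cases ha0 : a 0 = 0
        · grind
        · have h' : a 2 * (d * a 0 ^ 2 + a 0 * a 1 - a 1 ^ 2) = 0 := by
            linear_combination a 0 * hq + (a 1 - a 0) * hD
          rcases mul_eq_zero.1 h' with h' | h'
          · grind
          · exact ha0 (ne_zero_of_forall_sq_sub_self_ne hd h').1
    · refine ⟨![a 1 + a 3, -(a 0 + a 2), a 1 + a 3, -(a 0 + a 2)],
        Or.inl (Or.inr ⟨(_, _), rfl⟩), ?_, ?_⟩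
      · simp only [ha, Matrix.cons_val]
        ring
      · intro h
        simp only [Matrix.cons_val] at h
        exact hD (by linear_combination h)
  set t := (x 0 * a 0 + x 1 * a 1) / (y 0 * a 0 + y 1 * a 1) with ht
  have ht' : t * (y 0 * a 0 + y 1 * a 1) = x 0 * a 0 + x 1 * a 1 := div_mul_cancel₀ _ hy0
  have hyN : y ∈ N := Submodule.subset_span ⟨hy, hyf⟩
  have hx' : x = t • y + (x - t • y) := by abel
  rw [ha] at hyf
  rw [hx']
  refine N.add_mem (N.smul_mem t hyN) (hsplit _ ?_ ?_)
  · simp only [Pi.sub_apply, Pi.smul_apply, smul_eq_mul]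
    linear_combination -ht'
  · simp only [Pi.sub_apply, Pi.smul_apply, smul_eq_mul]
    linear_combination hfx - t * hyf + ht'

/-- Starting from four lines of `PG(3, F)`, repeated joining gives small strong blocking cones. -/
theorem exists_cone {F : Type*} [Field F] [Fintype F] (v : ℕ) (hv : 3 ≤ v) :
    ∃ S : Set (Fin (v + 1) → F), (0 : Fin (v + 1) → F) ∈ S ∧ (∀ (a : F), ∀ x ∈ S, a • x ∈ S) ∧
      (∀ f : (Fin (v + 1) → F) →ₗ[F] F,
        LinearMap.ker f ≤ Submodule.span F (S ∩ LinearMap.ker f)) ∧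
      S.ncard = (Fintype.card F - 1) *
        ((Fintype.card F - 1) * (v * (v + 1) / 2 - 2) + v + 5) + 1 := by
  induction v, hv using Nat.le_induction with
  | base =>
    obtain ⟨d, hd⟩ := exists_forall_sq_sub_self_ne F
    refine ⟨fourLines d, ?_, smul_mem_fourLines d, ker_le_span_fourLines hd, ?_⟩
    · exact Or.inl (Or.inl (Or.inl ⟨0, by ext i; fin_cases i <;> rfl⟩))
    · rw [ncard_fourLines hd]
      obtain ⟨k, hk⟩ : ∃ k, Fintype.card F = k + 1 :=
        ⟨_, (Nat.succ_pred_eq_of_pos Fintype.card_pos).symm⟩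
      have hsq : (k + 1) ^ 2 - 1 = k * (k + 2) := by
        rw [Nat.sub_eq_iff_eq_add (Nat.one_le_pow _ _ (by omega))]
        ring
      rw [hk, hsq]
      norm_num
      ring
  | succ v hv ih =>
    obtain ⟨S, h0, hS, hker, hcard⟩ := ih
    refine ⟨coneJoin S, Or.inl ⟨rfl, h0⟩, smul_mem_coneJoin h0 hS, ker_le_span_coneJoin hker, ?_⟩
    rw [ncard_coneJoin, hcard]
    have hdiv : (v + 1) * (v + 1 + 1) / 2 - 2 = (v * (v + 1) / 2 - 2) + (v + 1) := by
      have h1 : (v + 1) * (v + 1 + 1) = v * (v + 1) + (v + 1) * 2 := by ring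
      have h2 : 3 * 4 ≤ v * (v + 1) := Nat.mul_le_mul hv (by omega)
      rw [h1, Nat.add_mul_div_right _ _ (by norm_num)]
      omega
    rw [hdiv]
    ring

/-- Corollary 11. In `PG(v,q)`, `v ≥ 3`, there exists a `v`-fold strong
blocking set of size `(q-1)(v(v+1)/2 - 2) + v + 5`. -/
theorem statement7 (v : ℕ) (hv : 3 ≤ v) (F : Type*) [Field F] [Fintype F] :
    ∃ B : Set (Projectivization F (Fin (v + 1) → F)),
      IsStrongBlocking F (v + 1) v B ∧
      B.ncard = (Fintype.card F - 1) * (v * (v + 1) / 2 - 2) + v + 5 := by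
  obtain ⟨S, h0, hS, hker, hcard⟩ := exists_cone (F := F) v hv
  refine ⟨{P | P.rep ∈ S}, isStrongBlocking_of_ker_le_span S hS hker, ?_⟩
  rw [ncard_cone_eq S h0 hS, add_left_inj] at hcard
  have : 1 < Fintype.card F := Fintype.one_lt_card
  exact Nat.eq_of_mul_eq_mul_left (by omega) hcard
end
end

section
/- Let ρ ≥ 2 be an integer, let q' be a prime power, and let q = (q')^{ρ+1}. Then the space PG(ρ+1,q) contains a ρ-saturating set of size (q'−1)·((ρ+1)(ρ+2)/2 − 2) + ρ + 6. -/
noncomputable section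

/-- Representatives of the `K`-rational points of the line through `u` and `v`. -/
def rationalLine (K : Type*) {L V : Type*} [Field K] [Field L] [Algebra K L]
    [AddCommGroup V] [Module L V] (u v : V) : Set V :=
  insert u (Set.range fun s : K => v + algebraMap K L s • u)

section RationalLine

variable {K L V : Type*} [Field K] [Field L] [Algebra K L]
  [AddCommGroup V] [Module L V]

theorem ncard_rationalLine_le [Fintype K] (u v : V) :
    (rationalLine K (L := L) u v).ncard ≤ Fintype.card K + 1 := by
  refine (Set.ncard_insert_le _ _).trans ?_
  gcongr
  rw [← Set.image_univ]
  refine (Set.ncard_image_le Set.finite_univ).trans ?_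
  simp [Set.ncard_univ]

/-- If `g` vanishes on the rational points of a line at which the rational form `h` vanishes,
then `g` is proportional to `h` on that line. -/
theorem exists_proportional_on_line {h g : V →ₗ[L] L} {u v : V} {a b : K}
    (hu : h u = algebraMap K L a) (hv : h v = algebraMap K L b)
    (H : ∀ w ∈ rationalLine K (L := L) u v, h w = 0 → g w = 0) :
    ∃ c : L, g u = c * h u ∧ g v = c * h v := by
  by_cases ha : a = 0
  · have hu0 : h u = 0 := by simp [hu, ha]
    have gu0 : g u = 0 := H u (Set.mem_insert _ _) hu0
    by_cases hb : b = 0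
    · have hv0 : h v = 0 := by simp [hv, hb]
      have gv0 : g v = 0 := H v (Set.mem_insert_of_mem _ ⟨0, by simp⟩) hv0
      exact ⟨0, by simp [gu0], by simp [gv0]⟩
    · have hb' : h v ≠ 0 := by simpa [hv] using hb
      exact ⟨g v / h v, by simp [gu0, hu0], by field_simp⟩
  · have ha' : algebraMap K L a ≠ 0 := by simpa using ha
    have key := H (v + algebraMap K L (-b / a) • u) (Set.mem_insert_of_mem _ ⟨-b / a, rfl⟩)
      (by simp [hu, hv]; field_simp; ring)
    refine ⟨g u / h u, by rw [hu]; field_simp, ?_⟩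
    simp only [map_add, map_smul, smul_eq_mul, map_div₀, map_neg] at key
    rw [hu, hv]
    field_simp at key ⊢
    linear_combination key

end RationalLine

/-- The projective point of a nonzero vector, with an arbitrary fixed value at `0`. -/
def toPoint {F V : Type*} [Field F] [AddCommGroup V] [Module F V] [Nontrivial V] (v : V) :
    Projectivization F V :=
  open Classical in
  if h : v ≠ 0 then Projectivization.mk F v h else Classical.arbitrary _

theorem mem_span_rep_toPoint {F V : Type*} [Field F] [AddCommGroup V] [Module F V] [Nontrivial V]
    (v : V) : v ∈ Submodule.span F {(toPoint (F := F) v).rep} := by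
  by_cases h : v = 0
  · simp [h]
  · obtain ⟨a, ha⟩ := Projectivization.exists_smul_eq_mk_rep F v h
    have : toPoint (F := F) v = Projectivization.mk F v h := by simp [toPoint, h]
    rw [this, ← ha]
    exact Submodule.mem_span_singleton.2 ⟨((a⁻¹ : Fˣ) : F), by simp [Units.smul_def, smul_smul]⟩

/-- A set of vectors whose sections by the `K`-rational hyperplanes determine these hyperplanes
yields a saturating set over an extension `L` of `K` of degree `ρ + 1`. -/
theorem isSaturating_image_toPoint {K L : Type*} [Field K] [Field L] [Algebra K L]
    [FiniteDimensional K L] {ρ : ℕ} (hKL : Module.finrank K L = ρ + 1)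
    {B : Set (Fin (ρ + 2) → L)} (hB : B.Nonempty)
    (H : ∀ k : Fin (ρ + 2) → K, k ≠ 0 → ∀ h g : (Fin (ρ + 2) → L) →ₗ[L] L,
      (∀ i, h (Pi.single i 1) = algebraMap K L (k i)) →
      (∀ b ∈ B, h b = 0 → g b = 0) → ∃ c : L, g = c • h) :
    IsSaturating L (ρ + 2) ρ (toPoint '' B) := by
  intro P
  set x := P.rep with hx
  have hdep : ¬ LinearIndependent K x := fun hli => by
    have := hli.fintype_card_le_finrank
    simp [hKL] at this
  obtain ⟨k, hk, i, hki⟩ := Fintype.not_linearIndependent_iff.1 hdep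
  let h : (Fin (ρ + 2) → L) →ₗ[L] L := ∑ j, algebraMap K L (k j) • LinearMap.proj j
  have hsingle : ∀ j, h (Pi.single j 1) = algebraMap K L (k j) := by
    intro j
    simp [h, Pi.single_apply, Algebra.smul_def]
  have hhx : h x = 0 := by simpa [h, Algebra.smul_def] using hk
  set T : Set (Fin (ρ + 2) → L) := {b ∈ B | h b = 0} with hT
  have hxT : x ∈ Submodule.span L T := by
    by_contra hxT
    obtain ⟨g, hgx, hg⟩ := Submodule.exists_le_ker_of_notMem hxT
    obtain ⟨c, rfl⟩ := H k (fun h0 => hki (by simp [h0])) h g hsingle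
      (fun b hb hb0 => hg (Submodule.subset_span ⟨hb, hb0⟩))
    exact hgx (by simp [hhx])
  have hlt : Module.finrank L (Submodule.span L T) < ρ + 2 := by
    have hker : Submodule.span L T ≤ LinearMap.ker h := Submodule.span_le.2 fun b hb => hb.2
    have hne : Submodule.span L T ≠ ⊤ := fun htop => by
      have h1 : h (Pi.single i 1) = 0 := hker (htop ▸ Submodule.mem_top)
      rw [hsingle] at h1
      exact hki (by simpa using h1)
    simpa using Submodule.finrank_lt hne
  obtain ⟨f, hfT, hfspan, -⟩ := Submodule.exists_fun_fin_finrank_span_eq L T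
  obtain ⟨b₀, hb₀⟩ := hB
  let f' : Fin (ρ + 1) → Fin (ρ + 2) → L := fun j =>
    if hj : j.1 < Module.finrank L (Submodule.span L T) then f ⟨j, hj⟩ else b₀
  refine ⟨fun j => toPoint (f' j), fun j => ⟨f' j, ?_, rfl⟩, ?_⟩
  · by_cases hj : j.1 < Module.finrank L (Submodule.span L T)
    · simpa [f', hj] using (hfT ⟨j, hj⟩).1
    · simpa [f', hj] using hb₀
  · rw [← hfspan] at hxT
    refine Submodule.span_le.2 ?_ hxT
    rintro _ ⟨j, rfl⟩
    have hj : f j = f' ⟨j, by omega⟩ := by simp [f']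
    rw [hj]
    exact Submodule.span_mono (Set.singleton_subset_iff.2 (Set.mem_range_self _))
      (mem_span_rep_toPoint _)

/-- The norm form of a suitable quadratic extension of a finite field is anisotropic. -/
theorem exists_anisotropic_form (K : Type*) [Field K] [Finite K] :
    ∃ d : K, ∀ x y : K, x * x + x * y - d * (y * y) = 0 → x = 0 ∧ y = 0 := by
  have hinj : ¬ Function.Injective fun x : K => x * x + x := fun hi =>
    one_ne_zero (neg_eq_zero.1 (hi (show (-1 : K) * -1 + -1 = 0 * 0 + 0 by ring)))
  rw [Finite.injective_iff_surjective] at hinj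
  simp only [Function.Surjective, not_forall, not_exists] at hinj
  obtain ⟨d, hd⟩ := hinj
  refine ⟨d, fun x y hxy => ?_⟩
  by_cases hy : y = 0
  · subst hy
    exact ⟨by simpa using hxy, rfl⟩
  · exact absurd (by field_simp; linear_combination hxy) (hd (x / y))

/-- Proportionality of two forms on three lines of a regulus of `PG(3, K)` and on a fourth line
missing the corresponding quadric forces proportionality on the whole space. -/
theorem proportional_of_four_lines {K L : Type*} [Field K] [Field L] [Algebra K L] {d : K}
    (hd : ∀ x y : K, x * x + x * y - d * (y * y) = 0 → x = 0 ∧ y = 0)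
    {k₀ k₁ : K} {g₀ g₁ g₂ g₃ h₀ h₁ h₂ h₃ : L}
    (e₀ : h₀ = algebraMap K L k₀) (e₁ : h₁ = algebraMap K L k₁)
    (l₀ : ∃ c, g₀ = c * h₀ ∧ g₁ = c * h₁) (l₁ : ∃ c, g₂ = c * h₂ ∧ g₃ = c * h₃)
    (l₂ : ∃ c, g₀ + g₂ = c * (h₀ + h₂) ∧ g₁ + g₃ = c * (h₁ + h₃))
    (l₃ : ∃ c, g₀ + algebraMap K L d * g₃ = c * (h₀ + algebraMap K L d * h₃) ∧
      g₁ + g₂ + g₃ = c * (h₁ + h₂ + h₃)) :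
    ∃ c, g₀ = c * h₀ ∧ g₁ = c * h₁ ∧ g₂ = c * h₂ ∧ g₃ = c * h₃ := by
  obtain ⟨c₀, rfl, rfl⟩ := l₀
  obtain ⟨c₁, rfl, rfl⟩ := l₁
  obtain ⟨c₂, p₂, r₂⟩ := l₂
  obtain ⟨c₃, p₃, r₃⟩ := l₃
  suffices hs : c₀ = c₁ ∨ (h₀ = 0 ∧ h₁ = 0) ∨ (h₂ = 0 ∧ h₃ = 0) by
    rcases hs with rfl | ⟨z, z'⟩ | ⟨z, z'⟩
    · exact ⟨c₀, rfl, rfl, rfl, rfl⟩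
    · exact ⟨c₁, by simp [z], by simp [z'], rfl, rfl⟩
    · exact ⟨c₀, rfl, rfl, by simp [z], by simp [z']⟩
  by_cases hD : h₀ * h₃ - h₁ * h₂ = 0
  swap
  · left
    apply mul_right_cancel₀ hD
    linear_combination (h₃ + h₁) * p₂ - (h₂ + h₀) * r₂
  by_cases hE : h₀ * (h₂ + h₃) - algebraMap K L d * h₁ * h₃ = 0
  swap
  · left
    apply mul_right_cancel₀ hE
    linear_combination (h₁ + h₂ + h₃) * p₃ - (h₀ + algebraMap K L d * h₃) * r₃
  right
  by_cases hN : k₀ * k₀ + k₀ * k₁ - d * (k₁ * k₁) = 0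
  · obtain ⟨rfl, rfl⟩ := hd _ _ hN
    simp [e₀, e₁]
  · right
    have hN' : h₀ * h₀ + h₀ * h₁ - algebraMap K L d * (h₁ * h₁) ≠ 0 := by
      rw [e₀, e₁]
      simpa only [← map_mul, ← map_add, ← map_sub, map_ne_zero] using hN
    constructor
    · apply (mul_eq_zero.1 ?_).resolve_left hN'
      linear_combination h₀ * hE - (h₀ - algebraMap K L d * h₁) * hD
    · apply (mul_eq_zero.1 ?_).resolve_left hN'
      linear_combination h₁ * hE + h₀ * hD

section Blocking

variable (K L : Type*) [Field K] [Field L] [Algebra K L] (d : K) (m : ℕ)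

/-- The points off `PG(3, K)` on the lines joining each further coordinate point to the
preceding ones. -/
def joinVector : (Σ j : Fin m, Option (Fin (j + 4) × Kˣ)) → Fin (m + 4) → L
  | ⟨j, none⟩ => Pi.single (j.addNat 4) 1
  | ⟨j, some (i, s)⟩ => Pi.single (j.addNat 4) 1 +
      algebraMap K L s • Pi.single ⟨i, by omega⟩ 1

/-- Four lines in the first four coordinates together with iterated joins to the remaining
coordinate points. -/
def fourLinesJoin : Set (Fin (m + 4) → L) :=
  rationalLine K (L := L) (Pi.single 0 1) (Pi.single 1 1) ∪
  rationalLine K (L := L) (Pi.single 2 1) (Pi.single 3 1) ∪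
  rationalLine K (L := L) (Pi.single 0 1 + Pi.single 2 1) (Pi.single 1 1 + Pi.single 3 1) ∪
  rationalLine K (L := L) (Pi.single 0 1 + algebraMap K L d • Pi.single 3 1)
    (Pi.single 1 1 + Pi.single 2 1 + Pi.single 3 1) ∪
  Set.range (joinVector K L m)

theorem ncard_fourLinesJoin_le [Fintype K] : (fourLinesJoin K L d m).ncard ≤
    (Fintype.card K - 1) * ((m + 3) * (m + 4) / 2 - 2) + m + 8 := by
  classical
  have hrange : (Set.range (joinVector K L m)).ncard ≤
      ∑ j ∈ Finset.range m, ((j + 4) * (Fintype.card K - 1) + 1) := by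
    rw [← Set.image_univ]
    refine (Set.ncard_image_le Set.finite_univ).trans ?_
    rw [Set.ncard_univ, Nat.card_eq_fintype_card, Fintype.card_sigma, Finset.sum_range]
    simp [Fintype.card_units]
  have hsum : ∀ n t : ℕ, ∑ j ∈ Finset.range n, ((j + 4) * t + 1) + 4 * t =
      t * ((n + 3) * (n + 4) / 2 - 2) + n := by
    intro n t
    induction n with
    | zero => simp; ring
    | succ n ih =>
      have h : (n + 1 + 3) * (n + 1 + 4) / 2 - 2 = (n + 3) * (n + 4) / 2 - 2 + (n + 4) := by
        have h1 : (n + 1 + 3) * (n + 1 + 4) = (n + 3) * (n + 4) + (n + 4) * 2 := by ring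
        have h2 : 12 ≤ (n + 3) * (n + 4) := by nlinarith
        omega
      rw [Finset.sum_range_succ, h, mul_add]
      linarith
  have hK : 1 < Fintype.card K := Fintype.one_lt_card
  have := hsum m (Fintype.card K - 1)
  unfold fourLinesJoin
  grw [Set.ncard_union_le, Set.ncard_union_le, Set.ncard_union_le, Set.ncard_union_le, hrange,
    ncard_rationalLine_le, ncard_rationalLine_le, ncard_rationalLine_le, ncard_rationalLine_le]
  omega

variable {K L d m}

theorem exists_smul_of_vanishing_on_fourLinesJoin
    (hd : ∀ x y : K, x * x + x * y - d * (y * y) = 0 → x = 0 ∧ y = 0)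
    {k : Fin (m + 4) → K} (hk : k ≠ 0) {h g : (Fin (m + 4) → L) →ₗ[L] L}
    (hh : ∀ i, h (Pi.single i 1) = algebraMap K L (k i))
    (H : ∀ b ∈ fourLinesJoin K L d m, h b = 0 → g b = 0) : ∃ c : L, g = c • h := by
  have low : ∃ c, g (Pi.single 0 1) = c * h (Pi.single 0 1) ∧
      g (Pi.single 1 1) = c * h (Pi.single 1 1) ∧
      g (Pi.single 2 1) = c * h (Pi.single 2 1) ∧
      g (Pi.single 3 1) = c * h (Pi.single 3 1) := by
    refine proportional_of_four_lines hd (hh 0) (hh 1) ?_ ?_ ?_ ?_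
    · exact exists_proportional_on_line (hh 0) (hh 1) fun w hw =>
        H w (Or.inl (Or.inl (Or.inl (Or.inl hw))))
    · exact exists_proportional_on_line (hh 2) (hh 3) fun w hw =>
        H w (Or.inl (Or.inl (Or.inl (Or.inr hw))))
    · simpa only [map_add] using exists_proportional_on_line (K := K) (h := h) (g := g)
        (a := k 0 + k 2) (b := k 1 + k 3) (by simp [hh]) (by simp [hh]) fun w hw =>
        H w (Or.inl (Or.inl (Or.inr hw)))
    · simpa only [map_add, map_smul, smul_eq_mul] using
        exists_proportional_on_line (K := K) (h := h) (g := g)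
        (a := k 0 + d * k 3) (b := k 1 + k 2 + k 3)
        (by simp only [map_add, map_smul, hh, smul_eq_mul, map_mul]) (by simp [hh])
        fun w hw => H w (Or.inl (Or.inr hw))
  have basis_mem : ∀ i : Fin (m + 4),
      (Pi.single i 1 : Fin (m + 4) → L) ∈ fourLinesJoin K L d m := by
    rintro ⟨i, hi⟩
    match i, hi with
    | 0, _ => exact Or.inl (Or.inl (Or.inl (Or.inl (Set.mem_insert _ _))))
    | 1, _ => exact Or.inl (Or.inl (Or.inl (Or.inl (Set.mem_insert_of_mem _ ⟨0, by simp⟩))))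
    | 2, _ => exact Or.inl (Or.inl (Or.inl (Or.inr (Set.mem_insert _ _))))
    | 3, _ => exact Or.inl (Or.inl (Or.inl (Or.inr (Set.mem_insert_of_mem _ ⟨0, by simp; rfl⟩))))
    | n + 4, hn => exact Or.inr ⟨⟨⟨n, by omega⟩, none⟩, rfl⟩
  have minor_of_lt : ∀ i j : Fin (m + 4), i < j →
      g (Pi.single i 1) * h (Pi.single j 1) = g (Pi.single j 1) * h (Pi.single i 1) := by
    intro i j hij
    by_cases hj : 4 ≤ j.1
    · obtain ⟨c, hi', hj'⟩ := exists_proportional_on_line (hh i) (hh j) fun w hw => H w <| by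
        rcases hw with rfl | ⟨s, rfl⟩
        · exact basis_mem i
        · by_cases hs : s = 0
          · simpa [hs] using basis_mem j
          · refine Or.inr ⟨⟨⟨j.1 - 4, by omega⟩, some (⟨i.1, by simp; omega⟩, Units.mk0 s hs)⟩, ?_⟩
            have : Fin.addNat (⟨j.1 - 4, by omega⟩ : Fin m) 4 = j := Fin.ext (by simp; omega)
            simp [joinVector, this]
      rw [hi', hj']
      ring
    · obtain ⟨c, c₀, c₁, c₂, c₃⟩ := low
      have hc : ∀ l : Fin (m + 4), l.1 < 4 → g (Pi.single l 1) = c * h (Pi.single l 1) := by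
        rintro ⟨l, hl⟩ hl4
        match l, hl, hl4 with
        | 0, _, _ => exact c₀
        | 1, _, _ => exact c₁
        | 2, _, _ => exact c₂
        | 3, _, _ => exact c₃
      rw [hc i (by omega), hc j (by omega)]
      ring
  obtain ⟨l, hl⟩ := Function.ne_iff.1 hk
  have hl' : h (Pi.single l 1) ≠ 0 := by simpa [hh] using hl
  refine ⟨g (Pi.single l 1) / h (Pi.single l 1), LinearMap.pi_ext' fun i => LinearMap.ext_ring ?_⟩
  suffices g (Pi.single i 1) * h (Pi.single l 1) = g (Pi.single l 1) * h (Pi.single i 1) by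
    simpa [div_mul_eq_mul_div, eq_div_iff hl'] using this
  rcases lt_trichotomy i l with hil | rfl | hil
  · exact minor_of_lt i l hil
  · rfl
  · exact (minor_of_lt l i hil).symm

end Blocking


/-- A finite field whose cardinality is the `n`-th power of a prime power is an extension of
degree `n` of a field with that prime power as its cardinality. -/
theorem exists_subfield_of_card_eq_pow {q' n : ℕ} (hq' : IsPrimePow q')
    (L : Type*) [Field L] [Fintype L] (hL : Fintype.card L = q' ^ n) :
    ∃ (K : Type) (_ : Field K) (_ : Fintype K) (_ : Algebra K L),
      Fintype.card K = q' ∧ Module.finrank K L = n := by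
  obtain ⟨p, k, hp, hk, rfl⟩ := (isPrimePow_nat_iff _).1 hq'
  have : Fact p.Prime := ⟨hp⟩
  have hL' : Fintype.card L = p ^ (k * n) := by rw [hL, pow_mul]
  have : CharP L p := charP_of_card_eq_prime_pow hL'
  let _ : Algebra (ZMod p) L := ZMod.algebra L p
  have hfr : Module.finrank (ZMod p) L = k * n := by
    have := Module.card_eq_pow_finrank (K := ZMod p) (V := L)
    rw [hL', ZMod.card] at this
    exact (Nat.pow_right_injective hp.two_le this).symm
  obtain ⟨φ⟩ := FiniteField.nonempty_algHom_of_finrank_dvd (F := ZMod p)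
    (K := GaloisField p k) (L := L)
    (by rw [GaloisField.finrank p hk.ne', hfr]; exact dvd_mul_right _ _)
  let _ : Fintype (GaloisField p k) := Fintype.ofFinite _
  let _ : Algebra (GaloisField p k) L := φ.toRingHom.toAlgebra
  have hcard : Fintype.card (GaloisField p k) = p ^ k := by
    rw [← Nat.card_eq_fintype_card, GaloisField.card p k hk.ne']
  refine ⟨GaloisField p k, inferInstance, inferInstance, inferInstance, hcard, ?_⟩
  have := Module.card_eq_pow_finrank (K := GaloisField p k) (V := L)
  rw [hL, hcard] at this
  exact (Nat.pow_right_injective (hq'.two_le) this).symm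

theorem card_bound_le_pow {q n : ℕ} (hq : 2 ≤ q) (hn : 3 ≤ n) :
    (q - 1) * (n * (n + 1) / 2 - 2) + n + 5 ≤ (q ^ n) ^ n := by
  have h1 : n * (n + 1) / 2 ≤ n * n := Nat.div_le_of_le_mul (by nlinarith)
  have h2 : n * n < 2 ^ (n * n - 1) := by
    obtain ⟨t, ht⟩ : ∃ t, n * n = t + 9 := Nat.exists_eq_add_of_le' (by nlinarith)
    have := Nat.lt_two_pow_self (n := t)
    rw [ht, show t + 9 - 1 = t + 8 from rfl, pow_add]
    omega
  have h3 : 2 ^ (n * n - 1) ≤ q ^ (n * n - 1) := Nat.pow_le_pow_left hq _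
  have h4 : (q ^ n) ^ n = q ^ (n * n - 1) * q := by
    rw [← pow_mul, ← pow_succ]
    congr 1
    have : 0 < n * n := by positivity
    omega
  have h5 : n * (n + 1) / 2 - 2 ≤ n * n - 2 := by omega
  have h6 : n + 5 ≤ n * n := by nlinarith
  calc _ ≤ (q - 1) * (n * n) + n + 5 := by gcongr; omega
    _ ≤ (q - 1) * (n * n) + n * n := by omega
    _ = n * n * q := by
      obtain ⟨r, rfl⟩ := Nat.exists_eq_add_of_le' (show 1 ≤ q by omega)
      simp
      ring
    _ ≤ _ := by rw [h4]; gcongr; omega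

/-- Corollary 12. For `q = q'^{ρ+1}`, `ρ ≥ 2`, there exists a
`ρ`-saturating set of `PG(ρ+1,q)` of size `(q'-1)((ρ+1)(ρ+2)/2 - 2) + ρ + 6`. -/
theorem statement8 (ρ : ℕ) (hρ : 2 ≤ ρ) (q' : ℕ) (hq' : IsPrimePow q')
    (L : Type*) [Field L] [Fintype L] (hL : Fintype.card L = q' ^ (ρ + 1)) :
    ∃ S : Set (Projectivization L (Fin (ρ + 2) → L)),
      IsSaturating L (ρ + 2) ρ S ∧
      S.ncard = (q' - 1) * ((ρ + 1) * (ρ + 2) / 2 - 2) + ρ + 6 := by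
  obtain ⟨K, _, _, _, hK, hfr⟩ := exists_subfield_of_card_eq_pow hq' L hL
  have : FiniteDimensional K L := FiniteDimensional.of_finrank_eq_succ hfr
  obtain ⟨m, rfl⟩ := Nat.exists_eq_add_of_le' hρ
  obtain ⟨d, hd⟩ := exists_anisotropic_form K
  set B := fourLinesJoin K L d m
  have hsat : IsSaturating L (m + 2 + 2) (m + 2) (toPoint '' B) :=
    isSaturating_image_toPoint hfr ⟨_, Or.inl (Or.inr (Set.mem_insert _ _))⟩
      fun k hk h g hh H => exists_smul_of_vanishing_on_fourLinesJoin hd hk hh H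
  have hle : (toPoint (F := L) '' B).ncard ≤
      (q' - 1) * ((m + 2 + 1) * (m + 2 + 2) / 2 - 2) + (m + 2) + 6 := by
    refine (Set.ncard_image_le (Set.toFinite _)).trans ((ncard_fourLinesJoin_le K L d m).trans ?_)
    rw [hK]
    exact le_rfl
  have hcard : (q' - 1) * ((m + 2 + 1) * (m + 2 + 2) / 2 - 2) + (m + 2) + 6 ≤
      (Set.univ : Set (Projectivization L (Fin (m + 2 + 2) → L))).ncard := by
    rw [Set.ncard_univ, Projectivization.card_of_finrank L _ (Module.finrank_fin_fun L),
      Nat.card_eq_fintype_card, hL]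
    refine (card_bound_le_pow hq'.two_le (n := m + 2 + 1) (by omega)).trans ?_
    exact Finset.single_le_sum (f := fun i => (q' ^ (m + 2 + 1)) ^ i) (fun _ _ => Nat.zero_le _)
      (Finset.mem_range.2 (Nat.lt_succ_self _))
  obtain ⟨S, hBS, -, hS⟩ := Set.exists_subsuperset_card_eq (Set.subset_univ _) hle hcard
  exact ⟨S, hsat.mono hBS, hS⟩
end
end

section
/- Let q' be a prime power and let q = (q')^3. Then the space PG(3,q) contains a 2-saturating set of size 4q' + 4 consisting of the points of four pairwise skew lines of the subgeometry PG(3,q') ⊂ PG(3,q). -/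
noncomputable section

/-- On a finite field, `x ↦ x ^ 2 + x` identifies `0` and `-1`, so it misses some value. -/
theorem exists_forall_sq_add_self_ne (K : Type*) [Field K] [Finite K] :
    ∃ c : K, ∀ t : K, t ^ 2 + t ≠ c := by
  have h : ¬ Function.Surjective (fun t : K => t ^ 2 + t) := by
    rw [← Finite.injective_iff_surjective]
    intro hinj
    have h01 : (0 : K) = -1 := hinj (by norm_num)
    exact one_ne_zero (neg_eq_zero.mp h01.symm)
  simpa [Function.Surjective] using h

/-- Parametrizations of four lines of `PG(3, K)`: with `K ^ 4 = K ^ 2 × K ^ 2`, they are `(u, 0)`,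
`(0, u)`, `(u, u)` and `(u, A u)`, where `A` is a matrix satisfying `A ^ 2 + A = c`. -/
def lineMap {K : Type*} [Field K] (c : K) (i : Fin 4) : (K × K) →ₗ[K] (Fin 4 → K) where
  toFun u := ![![u.1, u.2, 0, 0], ![0, 0, u.1, u.2], ![u.1, u.2, u.1, u.2],
    ![u.1, u.2, c * u.2, u.1 - u.2]] i
  map_add' u v := by
    ext j
    fin_cases i <;> fin_cases j <;> simp <;> ring
  map_smul' a u := by
    ext j
    fin_cases i <;> fin_cases j <;> simp <;> ring

theorem lineMap_injective {K : Type*} [Field K] (c : K) (i : Fin 4) :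
    Function.Injective (lineMap c i) := by
  rintro ⟨a, b⟩ ⟨a', b'⟩ h
  have h0 := congrFun h 0
  have h1 := congrFun h 1
  have h2 := congrFun h 2
  have h3 := congrFun h 3
  fin_cases i <;> simp_all [lineMap]

theorem eq_zero_of_lineMap_eq {K : Type*} [Field K] {c : K} (hc : ∀ t : K, t ^ 2 + t ≠ c)
    {i j : Fin 4} (hij : i ≠ j) {u v : K × K} (h : lineMap c i u = lineMap c j v) :
    lineMap c i u = 0 := by
  wlog hlt : i < j generalizing i j u v
  · rw [h]
    exact this hij.symm h.symm (lt_of_le_of_ne (not_lt.mp hlt) hij.symm)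
  suffices hu : u = 0 by rw [hu, map_zero]
  obtain ⟨a, b⟩ := u
  obtain ⟨a', b'⟩ := v
  have h0 := congrFun h 0
  have h1 := congrFun h 1
  have h2 := congrFun h 2
  have h3 := congrFun h 3
  have hc0 : c ≠ 0 := fun h => hc 0 (by simp [h])
  have hc2 : c ≠ 2 := fun h => hc 1 (by rw [h]; norm_num)
  fin_cases i <;> fin_cases j <;> simp [lineMap] at hlt h0 h1 h2 h3
  · rw [h0, h1, Prod.mk_zero_zero]
  · rw [h0, h1, ← h2, ← h3, Prod.mk_zero_zero]
  · have hb' : b' = 0 := h2.resolve_left hc0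
    rw [h0, h1, sub_eq_zero.mp h3.symm, hb', Prod.mk_zero_zero]
  · rw [h2, h3, ← h0, ← h1, Prod.mk_zero_zero]
  · simp [h2, h3, ← h0, ← h1]
  · have hb' : (c - 2) * b' = 0 := by linear_combination h0 + h1 - h2 - h3
    have hb'' : b' = 0 := (mul_eq_zero.mp hb').resolve_left (sub_ne_zero.mpr hc2)
    simp [h1, h2, hb'']

/-- Every plane of `PG(3, K)` is spanned by three points on the four lines. -/
theorem exists_linearIndependent_lineMap {K : Type*} [Field K] {c : K}
    (hc : ∀ t : K, t ^ 2 + t ≠ c) {f : Fin 4 → K} (hf : f ≠ 0) :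
    ∃ p : Fin 3 → Fin 4 → K, LinearIndependent K p ∧
      (∀ i, ∃ k, p i ∈ LinearMap.range (lineMap c k)) ∧ ∀ i, ∑ j, f j * p i j = 0 := by
  have key (k : Fin 3 → Fin 4) (u : Fin 3 → K × K)
      (hind : ∀ g : Fin 3 → K, (∀ j, g 0 * lineMap c (k 0) (u 0) j + g 1 * lineMap c (k 1) (u 1) j
        + g 2 * lineMap c (k 2) (u 2) j = 0) → g 0 = 0 ∧ g 1 = 0 ∧ g 2 = 0)
      (hker : ∀ i, ∑ j, f j * lineMap c (k i) (u i) j = 0) :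
      ∃ p : Fin 3 → Fin 4 → K, LinearIndependent K p ∧
        (∀ i, ∃ k, p i ∈ LinearMap.range (lineMap c k)) ∧ ∀ i, ∑ j, f j * p i j = 0 := by
    refine ⟨fun i => lineMap c (k i) (u i), ?_, fun i => ⟨k i, u i, rfl⟩, hker⟩
    rw [Fintype.linearIndependent_iff]
    intro g hg
    obtain ⟨h0, h1, h2⟩ := hind g fun j => by simpa [Fin.sum_univ_three] using congrFun hg j
    intro i
    fin_cases i <;> assumption
  by_cases ha : f 0 = 0 ∧ f 1 = 0
  · obtain ⟨ha0, ha1⟩ := ha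
    refine key ![0, 0, 1] ![(1, 0), (0, 1), (f 3, -f 2)] (fun g hg => ?_) (fun i => ?_)
    · have h0 := hg 0
      have h1 := hg 1
      have h2 := hg 2
      have h3 := hg 3
      simp [lineMap] at h0 h1 h2 h3
      refine ⟨h0, h1, ?_⟩
      by_contra hg2
      refine hf (funext fun j => ?_)
      fin_cases j <;> simp_all
    · fin_cases i <;> simp [lineMap, Fin.sum_univ_four, ha0, ha1]
      ring
  by_cases hb : f 2 = 0 ∧ f 3 = 0
  · obtain ⟨hb2, hb3⟩ := hb
    refine key ![0, 1, 1] ![(f 1, -f 0), (1, 0), (0, 1)] (fun g hg => ?_) (fun i => ?_)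
    · have h0 := hg 0
      have h1 := hg 1
      have h2 := hg 2
      have h3 := hg 3
      simp [lineMap] at h0 h1 h2 h3
      refine ⟨?_, h2, h3⟩
      by_contra hg2
      refine hf (funext fun j => ?_)
      fin_cases j <;> simp_all
    · fin_cases i <;> simp [lineMap, Fin.sum_univ_four, hb2, hb3]
      ring
  have perp {x y s : K} (hxy : ¬ (x = 0 ∧ y = 0)) (h0 : s * y = 0) (h1 : s * x = 0) :
      s = 0 := by
    by_contra hs
    exact hxy ⟨(mul_eq_zero.mp h1).resolve_left hs, (mul_eq_zero.mp h0).resolve_left hs⟩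
  by_cases hD : f 0 * f 3 - f 1 * f 2 = 0
  · obtain ⟨l, hl2, hl3⟩ : ∃ l, f 2 = l * f 0 ∧ f 3 = l * f 1 := by
      by_cases h0 : f 0 = 0
      · have h1 : f 1 ≠ 0 := fun h1 => ha ⟨h0, h1⟩
        refine ⟨f 3 / f 1, ?_, by field_simp⟩
        have h2 : f 2 = 0 := by simpa [h0, h1] using hD
        rw [h0, h2, mul_zero]
      · refine ⟨f 2 / f 0, by field_simp, ?_⟩
        field_simp
        linear_combination hD
    have hl : l ≠ 0 := by
      rintro rfl
      exact hb ⟨by simpa using hl2, by simpa using hl3⟩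
    refine key ![0, 1, 3] ![(f 1, -f 0), (f 3, -f 2), (f 1 + c * f 2 - f 3, -(f 0 + f 3))]
      (fun g hg => ?_) (fun i => ?_)
    · have h0 := hg 0
      have h1 := hg 1
      have h2 := hg 2
      have h3 := hg 3
      simp [lineMap] at h0 h1 h2 h3
      simp only [hl2, hl3] at h0 h1 h2 h3
      have hg2 : g 2 = 0 := by
        by_contra hg2
        have hq : l * g 2 * (c * f 0 ^ 2 - f 0 * f 1 - f 1 ^ 2) = 0 := by
          linear_combination f 0 * h0 + f 1 * h1
        have hq' := (mul_eq_zero.mp hq).resolve_left (mul_ne_zero hl hg2)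
        by_cases hf0 : f 0 = 0
        · exact ha ⟨hf0, by simpa [hf0] using hq'⟩
        · refine hc (f 1 / f 0) ?_
          field_simp
          linear_combination -hq'
      simp only [hg2, zero_mul, add_zero] at h0 h1 h2 h3
      refine ⟨perp ha h0 (by simpa using h1), perp (x := l * f 0) (y := l * f 1) ?_ h2
        (by simpa using h3), hg2⟩
      simpa [hl] using ha
    · fin_cases i <;> simp [lineMap, Fin.sum_univ_four] <;> ring
  · refine key ![0, 1, 2] ![(f 1, -f 0), (f 3, -f 2), (f 1 + f 3, -(f 0 + f 2))]
      (fun g hg => ?_) (fun i => ?_)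
    · have h0 := hg 0
      have h1 := hg 1
      have h2 := hg 2
      have h3 := hg 3
      simp [lineMap] at h0 h1 h2 h3
      have hg2 : g 2 = 0 := by
        have : g 2 * (f 0 * f 3 - f 1 * f 2) = 0 := by linear_combination f 0 * h0 + f 1 * h1
        exact (mul_eq_zero.mp this).resolve_right hD
      simp only [hg2, zero_mul, add_zero] at h0 h1 h2 h3
      exact ⟨perp ha h0 (by simpa using h1), perp hb h2 (by simpa using h3), hg2⟩
    · fin_cases i <;> simp [lineMap, Fin.sum_univ_four] <;> ring

theorem span_range_eq_of_linearIndependent {K : Type*} [Field K] {f : Fin 4 → K} (hf : f ≠ 0)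
    {p : Fin 3 → Fin 4 → K} (hp : LinearIndependent K p) (hfp : ∀ i, ∑ j, f j * p i j = 0)
    {y : Fin 4 → K} (hy : ∑ j, f j * y j = 0) : y ∈ Submodule.span K (Set.range p) := by
  let φ : Module.Dual K (Fin 4 → K) := Fintype.linearCombination K f
  have hφ (z : Fin 4 → K) : φ z = ∑ j, f j * z j := by
    simp [φ, Fintype.linearCombination_apply, mul_comm]
  have hφ0 : φ ≠ 0 := by
    intro h
    refine hf (funext fun i => ?_)
    simpa [h, Pi.single_apply] using (hφ (Pi.single i 1)).symm
  have hle : Submodule.span K (Set.range p) ≤ LinearMap.ker φ := by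
    rw [Submodule.span_le]
    rintro _ ⟨i, rfl⟩
    exact (hφ _).trans (hfp i)
  rw [Submodule.eq_of_le_of_finrank_eq hle]
  · exact (hφ y).trans hy
  · have h1 := Module.Dual.finrank_ker_add_one_of_ne_zero hφ0
    have h2 := finrank_span_eq_card hp
    simp at h1 h2
    omega

/-- A vector over an extension of degree less than the dimension satisfies a linear equation over
the base field. -/
theorem exists_ne_zero_sum_smul_eq_zero {K L : Type*} [Field K] [Field L] [Algebra K L]
    [FiniteDimensional K L] {n : ℕ} (hn : Module.finrank K L < n) (x : Fin n → L) :
    ∃ f : Fin n → K, f ≠ 0 ∧ ∑ j, f j • x j = 0 := by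
  obtain ⟨f, hf, hf0⟩ := Submodule.exists_mem_ne_zero_of_ne_bot
    (LinearMap.ker_ne_bot_of_finrank_lt (f := Fintype.linearCombination K x) (by simpa using hn))
  exact ⟨f, hf0, by simpa [Fintype.linearCombination_apply] using hf⟩

/-- If `p` spans the hyperplane `f = 0` over `K`, then it spans it over the extension `L`. -/
theorem mem_span_algebraMap_comp {K L : Type*} [Field K] [Field L] [Algebra K L] {ι : Type*}
    {n : ℕ} {f : Fin n → K} {p : ι → Fin n → K}
    (hp : ∀ y : Fin n → K, ∑ j, f j * y j = 0 → y ∈ Submodule.span K (Set.range p))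
    {x : Fin n → L} (hx : ∑ j, f j • x j = 0) :
    x ∈ Submodule.span L (Set.range fun i => algebraMap K L ∘ p i) := by
  let b := Module.Basis.ofVectorSpace K L
  have hmap (y : Fin n → K) (hy : y ∈ Submodule.span K (Set.range p)) :
      algebraMap K L ∘ y ∈ Submodule.span L (Set.range fun i => algebraMap K L ∘ p i) := by
    induction hy using Submodule.span_induction with
    | mem y hy =>
      obtain ⟨i, rfl⟩ := hy
      exact Submodule.subset_span ⟨i, rfl⟩
    | zero =>
      convert Submodule.zero_mem _
      ext j
      simp
    | add y z _ _ hy hz =>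
      convert Submodule.add_mem _ hy hz
      ext j
      simp
    | smul a y _ hy =>
      convert Submodule.smul_mem _ (algebraMap K L a) hy
      ext j
      simp
  classical
  let s := Finset.univ.biUnion fun j => (b.repr (x j)).support
  have hxs : x = ∑ k ∈ s, b k • (algebraMap K L ∘ fun j => b.repr (x j) k) := by
    ext j
    conv_lhs => rw [← b.linearCombination_repr (x j)]
    rw [Finsupp.linearCombination_apply,
      Finsupp.sum_of_support_subset (s := s) _
        (Finset.subset_biUnion_of_mem (fun j => (b.repr (x j)).support) (Finset.mem_univ j)) _
        (by simp)]
    simp [Algebra.smul_def, mul_comm]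
  rw [hxs]
  refine Submodule.sum_mem _ fun k _ => Submodule.smul_mem _ _ (hmap _ (hp _ ?_))
  simpa using DFunLike.congr_fun (congrArg b.repr hx) k

theorem mk_rep_mem_iff {K V : Type*} [Field K] [AddCommGroup V] [Module K V] (W : Submodule K V)
    {v : V} (hv : v ≠ 0) : (Projectivization.mk K v hv).rep ∈ W ↔ v ∈ W := by
  obtain ⟨a, ha⟩ := Projectivization.exists_smul_eq_mk_rep K v hv
  rw [← ha]
  exact W.smul_mem_iff_of_isUnit a.isUnit

theorem ncard_setOf_rep_mem {K V : Type*} [Field K] [Finite K] [AddCommGroup V] [Module K V]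
    {W : Submodule K V} (hW : Module.finrank K W = 2) :
    {P : Projectivization K V | P.rep ∈ W}.ncard = Nat.card K + 1 := by
  rw [← Projectivization.card_of_finrank_two K W hW, ← Nat.card_coe_set_eq]
  have hinj := Projectivization.map_injective W.subtype W.injective_subtype
  rw [← Nat.card_range_of_injective hinj]
  congr 2
  ext P
  constructor
  · intro hP
    refine ⟨Projectivization.mk K ⟨P.rep, hP⟩ fun h => P.rep_nonzero (congrArg Subtype.val h), ?_⟩
    simp [Projectivization.map_mk]
  · rintro ⟨Q, rfl⟩
    induction Q using Projectivization.ind with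
    | h v hv =>
      rw [Projectivization.map_mk]
      exact (mk_rep_mem_iff W _).mpr v.2

theorem subgeom_injective {m : ℕ} (K L : Type*) [Field K] [Field L] [Algebra K L] :
    Function.Injective (subgeom (m := m) K L) := by
  intro P Q h
  obtain ⟨a, ha⟩ := (Projectivization.mk_eq_mk_iff' L _ _ _ _).mp h
  rw [← P.mk_rep, ← Q.mk_rep, Projectivization.mk_eq_mk_iff']
  obtain ⟨i, hi⟩ := Function.ne_iff.mp Q.rep_nonzero
  have hi' : algebraMap K L (Q.rep i) ≠ 0 := by simpa using hi
  have ha' : a = algebraMap K L (P.rep i / Q.rep i) := by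
    rw [map_div₀, eq_div_iff hi']
    exact congrFun ha i
  refine ⟨P.rep i / Q.rep i, funext fun j => (algebraMap K L).injective ?_⟩
  simpa [ha'] using congrFun ha j

theorem algebraMap_comp_mem_span_subgeom {m : ℕ} {K : Type*} (L : Type*) [Field K] [Field L]
    [Algebra K L] {v : Fin m → K} (hv : v ≠ 0) :
    algebraMap K L ∘ v ∈
      Submodule.span L {(subgeom K L (Projectivization.mk K v hv)).rep} := by
  obtain ⟨a, ha⟩ := Projectivization.exists_smul_eq_mk_rep K v hv
  obtain ⟨b, hb⟩ := Projectivization.exists_smul_eq_mk_rep L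
    (fun i => algebraMap K L ((Projectivization.mk K v hv).rep i)) (by
      intro h
      refine (Projectivization.mk K v hv).rep_nonzero (funext fun i => ?_)
      simpa using congrFun h i)
  rw [Submodule.mem_span_singleton]
  refine ⟨algebraMap K L (a⁻¹ : Kˣ) * (b⁻¹ : Lˣ), ?_⟩
  rw [subgeom, ← hb, ← ha]
  ext i
  have ha0 : algebraMap K L a ≠ 0 := by simp
  simp [Units.smul_def]
  field_simp

/-- Corollary 13. For `q = q'^3` the space `PG(3,q)` contains a
`2`-saturating set of size `4q' + 4` consisting of four pairwise skew lines of the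
subgeometry `PG(3,q') ⊂ PG(3,q)`. -/
theorem statement9 (q' : ℕ) (hq' : IsPrimePow q')
    (K L : Type*) [Field K] [Fintype K] [Field L] [Fintype L] [Algebra K L]
    (hK : Fintype.card K = q') (hL : Fintype.card L = q' ^ 3) :
    ∃ W : Fin 4 → Submodule K (Fin 4 → K),
      (∀ i, Module.finrank K (W i) = 2) ∧
      (∀ i j, i ≠ j → W i ⊓ W j = ⊥) ∧
      IsSaturating L 4 2
        (subgeom K L '' (⋃ i, {P : Projectivization K (Fin 4 → K) | P.rep ∈ W i})) ∧
      (subgeom K L ''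
        (⋃ i, {P : Projectivization K (Fin 4 → K) | P.rep ∈ W i})).ncard = 4 * q' + 4 := by
  subst hK
  obtain ⟨c, hc⟩ := exists_forall_sq_add_self_ne K
  have hfin : ∀ i, Module.finrank K (LinearMap.range (lineMap c i)) = 2 := fun i => by
    rw [LinearMap.finrank_range_of_inj (lineMap_injective c i)]
    simp
  have hskew : ∀ i j, i ≠ j → LinearMap.range (lineMap c i) ⊓ LinearMap.range (lineMap c j) = ⊥ := by
    intro i j hij
    rw [eq_bot_iff]
    rintro _ ⟨⟨u, rfl⟩, v, hv⟩
    exact eq_zero_of_lineMap_eq hc hij hv.symm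
  refine ⟨fun i => LinearMap.range (lineMap c i), hfin, hskew, fun P => ?_, ?_⟩
  · have hKL : Module.finrank K L = 3 := by
      rw [Module.card_eq_pow_finrank (K := K)] at hL
      exact Nat.pow_right_injective Fintype.one_lt_card hL
    obtain ⟨f, hf, hfP⟩ := exists_ne_zero_sum_smul_eq_zero (K := K) (by omega) P.rep
    obtain ⟨p, hp, hpk, hfp⟩ := exists_linearIndependent_lineMap hc hf
    refine ⟨fun i => subgeom K L (Projectivization.mk K (p i) (hp.ne_zero i)), fun i => ?_, ?_⟩
    · obtain ⟨k, hk⟩ := hpk i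
      exact ⟨_, Set.mem_iUnion.mpr ⟨k, (mk_rep_mem_iff _ _).mpr hk⟩, rfl⟩
    · have hspan := mem_span_algebraMap_comp (L := L)
        (fun y => span_range_eq_of_linearIndependent hf hp hfp) hfP
      refine Submodule.span_le.mpr ?_ hspan
      rintro _ ⟨i, rfl⟩
      exact Submodule.span_mono (Set.singleton_subset_iff.mpr (Set.mem_range_self i))
        (algebraMap_comp_mem_span_subgeom L (hp.ne_zero i))
  · rw [Set.ncard_image_of_injective _ (subgeom_injective K L), Set.ncard_iUnion_of_finite]
    · simp only [ncard_setOf_rep_mem (hfin _), finsum_eq_sum_of_fintype]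
      simp
      ring
    · exact fun i => Set.toFinite _
    · intro i j hij
      refine Set.disjoint_left.mpr fun P hPi hPj => P.rep_nonzero ?_
      exact (Submodule.mem_bot K).mp (hskew i j hij ▸ Submodule.mem_inf.mpr ⟨hPi, hPj⟩)
end
end

section
/- Let q be a prime power, let v ≥ 2, and fix an integer k with 1 ≤ k ≤ v−1. Let B_k be the set of points of PG(v,q) whose representative vectors have at least k zero coordinates (equivalently, Hamming weight at most v−k+1). Then B_k is a (k+1)-fold strong blocking set of PG(v,q), and |B_k| = (V_q(v+1, v−k+1) − 1)/(q−1). -/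
noncomputable section

/-- The projection onto some `finrank W` coordinates restricts to an isomorphism on `W`. -/
theorem exists_equivFun_coord {F ι : Type*} [Field F] [Finite ι] {t : ℕ}
    (W : Submodule F (ι → F)) (hW : Module.finrank F W = t) :
    ∃ (s : Fin t → ι) (e : W ≃ₗ[F] (Fin t → F)), ∀ w i, e w i = w.1 (s i) := by
  let c : ι → Module.Dual F W := fun i => (LinearMap.proj i).comp W.subtype
  obtain ⟨f, hfc, hspan, -⟩ := Submodule.exists_fun_fin_finrank_span_eq F (Set.range c)
  have hinj : Function.Injective (LinearMap.pi f) := by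
    rw [← LinearMap.ker_eq_bot, LinearMap.ker_eq_bot']
    intro w hw
    have hle : Submodule.span F (Set.range f) ≤ LinearMap.ker (Module.Dual.eval F W w) := by
      rw [Submodule.span_le]
      rintro _ ⟨i, rfl⟩
      exact congrFun hw i
    ext i
    exact hle (hspan.ge (Submodule.subset_span (Set.mem_range_self i)))
  have hrank : Module.finrank F (Submodule.span F (Set.range c)) = t := by
    refine le_antisymm ?_ ?_
    · rw [← hW, ← Subspace.dual_finrank_eq]
      exact Submodule.finrank_le _
    · have := LinearMap.finrank_le_finrank_of_injective hinj
      rwa [Module.finrank_fin_fun, hW] at this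
  revert f
  rw [hrank]
  intro f hfc hspan hinj
  choose s hs using hfc
  refine ⟨s, LinearEquiv.ofInjectiveOfFinrankEq _ hinj (by simp [hW]), fun w i => ?_⟩
  exact (LinearMap.congr_fun (hs i) w).symm

/-- Nonzero scalar multiples have the same zero coordinates. -/
theorem setOf_mk_rep_eq_zero {F ι : Type*} [Field F] (x : ι → F) (hx : x ≠ 0) :
    {i | (Projectivization.mk F x hx).rep i = 0} = {i | x i = 0} := by
  obtain ⟨a, ha⟩ := Projectivization.exists_smul_eq_mk_rep F x hx
  ext i
  simp [← ha, Units.smul_def]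

/-- The points with at least `k` zero coordinates form a `(k+1)`-fold strong blocking set. -/
theorem isStrongBlocking_setOf_le_ncard (F : Type*) [Field F] (m k : ℕ) :
    IsStrongBlocking F m (k + 1)
      {P : Projectivization F (Fin m → F) | k ≤ {i | P.rep i = 0}.ncard} := by
  intro W hW
  obtain ⟨s, e, he⟩ := exists_equivFun_coord W hW
  have hs : Function.Injective s := by
    intro i j hij
    by_contra hne
    have h := he (e.symm (Pi.single i 1))
    have hi := h i
    have hj := h j
    rw [← hij, ← hi] at hj
    simp [Ne.symm hne] at hj
  let b := Module.Basis.ofEquivFun e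
  have hb0 (i) : (b i : Fin m → F) ≠ 0 := by
    simpa using b.ne_zero i
  have hbs (i j) (hij : j ≠ i) : (b i : Fin m → F) (s j) = 0 := by
    rw [← he]
    simp [b, hij]
  refine ⟨fun i => Projectivization.mk F (b i) (hb0 i), fun i => ?_, ?_⟩
  · simp only [Set.mem_ofPred_eq, setOf_mk_rep_eq_zero]
    calc k = (s '' {i}ᶜ).ncard := by
          rw [Set.ncard_image_of_injective _ hs, Set.ncard_compl]
          simp
      _ ≤ _ := by
          refine Set.ncard_le_ncard ?_ (Set.toFinite _)
          rintro _ ⟨j, hj, rfl⟩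
          exact hbs i j hj
  · choose a ha using fun i => Projectivization.exists_smul_eq_mk_rep F _ (hb0 i)
    simp only [← ha]
    have hspan : Submodule.span F (Set.range fun i => (b i : Fin m → F)) = W := by
      have h := congrArg (Submodule.map W.subtype) b.span_eq
      rwa [Submodule.map_span, ← Set.range_comp, Submodule.map_subtype_top] at h
    refine le_antisymm (Submodule.span_le.2 ?_) ?_
    · rintro _ ⟨i, rfl⟩
      exact W.smul_mem _ (b i).2
    · refine hspan.ge.trans (Submodule.span_le.2 ?_)
      rintro _ ⟨i, rfl⟩
      have := Submodule.smul_mem (Submodule.span F (Set.range fun i => a i • (b i : Fin m → F)))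
        (↑(a i)⁻¹ : F) (Submodule.subset_span ⟨i, rfl⟩)
      simpa [Units.smul_def] using this

/-- The number of vectors of Hamming weight at most `R`. -/
theorem card_hammingNorm_le (F : Type*) [Field F] [Fintype F] [DecidableEq F] (n R : ℕ) :
    Fintype.card {x : Fin n → F // hammingNorm x ≤ R} = sphereCard (Fintype.card F) n R := by
  have hfib (s : Finset (Fin n)) :
      (Finset.univ.filter fun x : Fin n → F => Finset.univ.filter (fun i => x i ≠ 0) = s).card
        = (Fintype.card F - 1) ^ s.card := by
    have : (Finset.univ.filter fun x : Fin n → F => Finset.univ.filter (fun i => x i ≠ 0) = s)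
        = Fintype.piFinset fun i => if i ∈ s then Finset.univ.erase (0 : F) else {0} := by
      ext x
      simp only [Finset.mem_filter, Finset.mem_univ, true_and, Finset.ext_iff,
        Fintype.mem_piFinset]
      refine forall_congr' fun i => ?_
      by_cases h : i ∈ s <;> simp [h]
    rw [this, Fintype.card_piFinset]
    simp [apply_ite Finset.card]
  have hsum : Fintype.card {x : Fin n → F // hammingNorm x ≤ R} =
      ∑ s ∈ (Finset.univ : Finset (Fin n)).powerset,
        if s.card ≤ R then (Fintype.card F - 1) ^ s.card else 0 := by
    rw [Fintype.card_subtype, Finset.card_eq_sum_card_fiberwise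
      (f := fun x : Fin n → F => Finset.univ.filter (fun i => x i ≠ 0))
      (t := (Finset.univ : Finset (Fin n)).powerset) (by intro x; simp)]
    refine Finset.sum_congr rfl fun s _ => ?_
    rw [Finset.filter_filter]
    split_ifs with h
    · rw [← hfib]
      congr 1
      ext x
      simp only [Finset.mem_filter, Finset.mem_univ, true_and, and_iff_right_iff_imp]
      rintro rfl
      exact h
    · rw [Finset.card_eq_zero, Finset.filter_eq_empty_iff]
      rintro x - ⟨hx, rfl⟩
      exact h hx
  rw [hsum, Finset.sum_powerset_apply_card
    (f := fun j => if j ≤ R then (Fintype.card F - 1) ^ j else 0), sphereCard]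
  simp only [Finset.card_univ, Fintype.card_fin, smul_eq_mul, mul_ite, mul_zero]
  rw [← Finset.sum_filter]
  have hsub : (Finset.range (n + 1)).filter (· ≤ R) ⊆ Finset.range (R + 1) := by
    intro j
    simp only [Finset.mem_filter, Finset.mem_range]
    omega
  simp only [mul_comm (n.choose _)]
  refine Finset.sum_subset hsub fun j hj hj' => ?_
  simp only [Finset.mem_range, Finset.mem_filter, not_and, not_le] at hj hj'
  rw [Nat.choose_eq_zero_of_lt (by omega), mul_zero]

/-- Counting vectors of bounded weight through the points they represent. -/
theorem ncard_setOf_le_ncard_mul (F : Type*) [Field F] [Fintype F] (m k : ℕ) (hk : k ≤ m) :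
    {P : Projectivization F (Fin m → F) | k ≤ {i | P.rep i = 0}.ncard}.ncard
        * (Fintype.card F - 1) = sphereCard (Fintype.card F) m (m - k) - 1 := by
  classical
  have hw (x : Fin m → F) : k ≤ {i | x i = 0}.ncard ↔ hammingNorm x ≤ m - k := by
    have h := Set.ncard_add_ncard_compl {i | x i = 0}
    have h' : {i | x i = 0}ᶜ.ncard = hammingNorm x := by
      rw [hammingNorm, ← Set.ncard_coe_finset]
      congr 1
      ext i
      simp
    rw [h', Nat.card_eq_fintype_card, Fintype.card_fin] at h
    omega
  have hrep (P : Projectivization F (Fin m → F)) (a : Fˣ) :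
      hammingNorm (a • P.rep) = hammingNorm P.rep := by
    simp [hammingNorm, Units.smul_def]
  let B := {P : Projectivization F (Fin m → F) | k ≤ {i | P.rep i = 0}.ncard}
  let f : B × Fˣ → {x : {x : Fin m → F // hammingNorm x ≤ m - k} // x ≠ ⟨0, by simp⟩} :=
    fun p => ⟨⟨p.2 • p.1.1.rep, by rw [hrep, ← hw]; exact p.1.2⟩, by
      simp [Subtype.ext_iff, Units.smul_def, Projectivization.rep_nonzero]⟩
  have hf : Function.Bijective f := by
    constructor
    · rintro ⟨⟨P, hP⟩, a⟩ ⟨⟨Q, hQ⟩, b⟩ h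
      have h : a • P.rep = b • Q.rep := congrArg (fun x => x.1.1) h
      have hPQ : P = Q := by
        rw [← P.mk_rep, ← Q.mk_rep, Projectivization.mk_eq_mk_iff]
        exact ⟨a⁻¹ * b, by rw [mul_smul, ← h, inv_smul_smul]⟩
      subst hPQ
      have hab : a = b := Units.ext (smul_left_injective F P.rep_nonzero h)
      rw [hab]
    · rintro ⟨⟨x, hx⟩, hx0⟩
      have hx0 : x ≠ 0 := fun h => hx0 (Subtype.ext h)
      obtain ⟨a, ha⟩ := Projectivization.exists_smul_eq_mk_rep F x hx0
      refine ⟨⟨⟨Projectivization.mk F x hx0, ?_⟩, a⁻¹⟩, ?_⟩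
      · simp only [B, Set.mem_ofPred_eq, setOf_mk_rep_eq_zero]
        exact (hw x).2 hx
      · apply Subtype.ext
        apply Subtype.ext
        simp [f, ← ha]
  have h := Nat.card_congr (Equiv.ofBijective f hf)
  rw [Nat.card_prod, Nat.card_coe_set_eq, Nat.card_eq_fintype_card, Fintype.card_units] at h
  rw [h, Nat.card_eq_fintype_card, Fintype.card_subtype_compl, card_hammingNorm_le]
  simp

/-- Lemma 14. Let `B_k ⊆ PG(v,q)` be the set of points with at least `k`
zero coordinates (Hamming weight at most `v-k+1`). Then `B_k` is a `(k+1)`-fold strong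
blocking set and `|B_k| = (V_q(v+1, v-k+1) - 1)/(q-1)`. -/
theorem statement10 (F : Type*) [Field F] [Fintype F] (v k : ℕ) (hv : 2 ≤ v)
    (hk1 : 1 ≤ k) (hkv : k ≤ v - 1) :
    IsStrongBlocking F (v + 1) (k + 1)
      {P : Projectivization F (Fin (v + 1) → F) | k ≤ {i | P.rep i = 0}.ncard} ∧
    {P : Projectivization F (Fin (v + 1) → F) | k ≤ {i | P.rep i = 0}.ncard}.ncard
      = (sphereCard (Fintype.card F) (v + 1) (v - k + 1) - 1) / (Fintype.card F - 1) := by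
  refine ⟨isStrongBlocking_setOf_le_ncard F (v + 1) k, ?_⟩
  have h := ncard_setOf_le_ncard_mul F (v + 1) k (by omega)
  rw [show v + 1 - k = v - k + 1 by omega] at h
  rw [← h, Nat.mul_div_cancel _ (Nat.sub_pos_of_lt Fintype.one_lt_card)]
end
end
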